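/- Let φ be the potential of the construction for a strictly increasing sequence (β_n)⊂[α,∞) with 0<α<β_1. Then for every ergodic shift-invariant probability measure μ on X and every β with β∈[β_{n−1},β_n] for some n>1, or β∈[α,β_1] for n=1, one has h_μ(T)+β∫φ dμ ≤ h_n+βc_n = h_{μ_n}(T)+β∫φ dμ_n, where μ_n is the unique measure of maximal entropy of X_n. Consequently, for all β≥α, P_top(βφ)=sup_n P_top(X_n,βφ)=sup_n (h_n+βc_n). -/

import Mathlib

open MeasureTheory Real Filter Topology

noncomputable section

namespace PhaseTransitions

/-! ### Measure-theoretic entropy and topological pressure -/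

/-- Base-2 entropy of the (finite, measurable) partition of `X` induced by an
observable `f : X → F` with finitely many values. -/
def entOfObs {X F : Type*} [MeasurableSpace X] [Fintype F]
    (μ : Measure X) (f : X → F) : ℝ :=
  ∑ a : F, -((μ (f ⁻¹' {a})).toReal * Real.logb 2 (μ (f ⁻¹' {a})).toReal)

/-- Entropy of the transformation `T` with respect to the partition induced by
the observable `f` : the limit (= infimum) of `(1/n) H(⋁_{i<n} T⁻ⁱ f)`. -/
def entObsT {X F : Type*} [MeasurableSpace X] [Fintype F]
    (T : X → X) (μ : Measure X) (f : X → F) : ℝ :=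
  ⨅ n : ℕ, entOfObs μ (fun x => fun i : Fin (n + 1) => f (T^[(i : ℕ)] x)) / (n + 1)

/-- Kolmogorov–Sinai (measure-theoretic) entropy, base 2: supremum over all
finite measurable partitions (encoded by observables with values in `Fin k`). -/
def kolSinai {X : Type*} [MeasurableSpace X] (T : X → X) (μ : Measure X) : ℝ :=
  ⨆ k : ℕ, ⨆ f : {f : X → Fin k // Measurable f}, entObsT T μ f.1

/-- `μ` is a `T`-invariant Borel probability measure. -/
def InvProb {X : Type*} [MeasurableSpace X] (T : X → X) (μ : Measure X) : Prop :=
  IsProbabilityMeasure μ ∧ MeasurePreserving T μ μ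

/-- Topological pressure, via the variational principle. -/
def pressure {X : Type*} [MeasurableSpace X] (T : X → X) (φ : X → ℝ) : ℝ :=
  ⨆ μ : {μ : Measure X // InvProb T μ}, (kolSinai T μ.1 + ∫ x, φ x ∂μ.1)

/-- An equilibrium state of the potential `φ`: an invariant probability measure
attaining the supremum in the variational principle. -/
def IsEquilibrium {X : Type*} [MeasurableSpace X] (T : X → X) (φ : X → ℝ)
    (μ : Measure X) : Prop :=
  InvProb T μ ∧ kolSinai T μ + ∫ x, φ x ∂μ = pressure T φ

/-! ### The two-sided full shift on two symbols -/

/-- The two-sided full shift space `{0,1}^ℤ`. -/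
abbrev Bin : Type := ℤ → Bool

/-- The (left) shift map. -/
def shift (x : Bin) : Bin := fun n => x (n + 1)

/-- `x` is a bi-infinite free concatenation of words from `W`: there is a
bi-infinite increasing sequence of cut points, cofinal in both directions, such
that consecutive cut points delimit words of `W`. -/
def IsFreeConcat (W : Set (List Bool)) (x : Bin) : Prop :=
  ∃ t : ℤ → ℤ, StrictMono t ∧ (∀ N : ℤ, ∃ k, N < t k) ∧ (∀ N : ℤ, ∃ k, t k < N) ∧
    ∀ k : ℤ, ∃ w ∈ W, t (k + 1) = t k + w.length ∧
      ∀ (i : ℕ) (h : i < w.length), x (t k + (i : ℤ)) = w.get ⟨i, h⟩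

/-- The coded system generated by the word set `W`: the closure of the set of
free concatenations of words from `W`. -/
def codedSystem (W : Set (List Bool)) : Set Bin :=
  closure {x | IsFreeConcat W x}

/-- The generating set `W_n = {0^{2^n-1}1, 1^{2^n-1}0}`. -/
def genWords (n : ℕ) : Set (List Bool) :=
  {List.replicate (2 ^ n - 1) false ++ [true], List.replicate (2 ^ n - 1) true ++ [false]}

/-- The subshift `X_n`, the coded system generated by `W_n`. -/
def Xsub (n : ℕ) : Set Bin := codedSystem (genWords n)

/-- The set of words of length `j` in the language of `Y ⊆ {0,1}^ℤ`. -/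
def langWord (Y : Set Bin) (j : ℕ) : Set (Fin j → Bool) :=
  {w | ∃ x ∈ Y, ∀ i : Fin j, x ((i : ℕ) : ℤ) = w i}

/-! ### The metric and the potential -/

open Classical in
/-- The metric `d(x,y) = 2^{-inf{|n| : x_n ≠ y_n}}` on the shift space. -/
def binDist (x y : Bin) : ℝ :=
  if x = y then 0
  else (1 / 2 : ℝ) ^ sInf {m : ℕ | ∃ i : ℤ, i.natAbs = m ∧ x i ≠ y i}

/-- Distance from a point to a set. -/
def distToSet (x : Bin) (S : Set Bin) : ℝ :=
  sInf ((fun y => binDist x y) '' S)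

/-- `δ_j = (10 + 3 log₂ j)/(α j)`. -/
def deltaSeq (α : ℝ) (j : ℕ) : ℝ := (10 + 3 * Real.logb 2 j) / (α * j)

/-- The drop `δ` as a function of the distance `r`: if `r = 2^{-j}` this equals
`δ_j = (10 + 3 log₂ j)/(α j)`, and `δ = 0` when `r = 0` (i.e. `δ_∞ = 0`). -/
def deltaOf (α : ℝ) (r : ℝ) : ℝ :=
  if r = 0 then 0
  else (10 + 3 * Real.logb 2 (-Real.logb 2 r)) / (α * (-Real.logb 2 r))

/-- `c_n = -∑_{j=n}^∞ 1/(2^{j+1} β_j)`. -/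
def cseq (β : ℕ → ℝ) (n : ℕ) : ℝ :=
  -∑' k : ℕ, 1 / (2 ^ (n + k + 1) * β (n + k))

/-- `φ_n(x) = c_n − δ_j` when `dist(x, X_n) = 2^{-j}` (and `φ_n = c_n` on `X_n`). -/
def phiN (α : ℝ) (c : ℕ → ℝ) (n : ℕ) (x : Bin) : ℝ :=
  c n - deltaOf α (distToSet x (Xsub n))

/-- The potential `φ = sup_{n ≥ 1} φ_n`. -/
def phi (α : ℝ) (c : ℕ → ℝ) (x : Bin) : ℝ :=
  ⨆ n : ℕ, phiN α c (n + 1) x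

/-- The constants of the finite (truncated) construction:
`c_{n} = c_1 + ∑_{j=1}^{n-1} 1/(2^{j+1} β_j)`. -/
def cseqFin (c1 : ℝ) (β : ℕ → ℝ) (n : ℕ) : ℝ :=
  c1 + ∑ j ∈ Finset.Ico 1 n, 1 / (2 ^ (j + 1) * β j)

/-- The truncated potential `φ = max{φ_n : 1 ≤ n ≤ N+1}`. -/
def phiFin (α : ℝ) (c : ℕ → ℝ) (N : ℕ) (x : Bin) : ℝ :=
  ⨆ n : Fin (N + 1), phiN α c ((n : ℕ) + 1) x

/-! ### Measures of maximal entropy and relative pressure -/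

/-- `μ` is a measure of maximal entropy for the subsystem `Y` (a `T`-invariant
probability measure giving full mass to `Y` and maximizing entropy among such). -/
def IsMaxEntropyOn (Y : Set Bin) (μ : Measure Bin) : Prop :=
  InvProb shift μ ∧ μ Y = 1 ∧
    ∀ ν : Measure Bin, InvProb shift ν → ν Y = 1 → kolSinai shift ν ≤ kolSinai shift μ

/-- The topological pressure of the subsystem `Y` (computed via the variational
principle over invariant measures giving full mass to `Y`). -/
def pressureOn (Y : Set Bin) (φ : Bin → ℝ) : ℝ :=
  ⨆ μ : {μ : Measure Bin // InvProb shift μ ∧ μ Y = 1},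
    (kolSinai shift μ.1 + ∫ x, φ x ∂μ.1)

/-! ### The pin-sequence space -/

/-- `Y`, the closure of the union of the `X_n`, `n ≥ 1`. -/
def Yset : Set Bin := closure (⋃ n : ℕ, Xsub (n + 1))

/-- The word `x_i ⋯ x_j` belongs to the language of `Y`. -/
def SegIn (x : Bin) (i j : ℤ) (Y : Set Bin) : Prop :=
  ∃ y ∈ Y, ∀ m : ℤ, i ≤ m → m ≤ j → y (m - i) = x m

/-- The word `x_0 ⋯ x_{j-1}` belongs to the language of `Y`. -/
def WordIn (x : Bin) (j : ℕ) (Y : Set Bin) : Prop :=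
  ∃ y ∈ Y, ∀ m : ℕ, m < j → y (m : ℤ) = x (m : ℤ)

/-- The pin-sequence space `P ⊆ X × {0,1}^ℤ`: pinless stretches of `x` lie in the
language of `Y`, and stretches between two pins do not. -/
def PinSpace : Set (Bin × Bin) :=
  {p | (∀ i j : ℤ, i < j → (∀ k : ℤ, i < k → k ≤ j → p.2 k = false) → SegIn p.1 i j Yset) ∧
       (∀ i j : ℤ, i < j → p.2 i = true → p.2 j = true → ¬ SegIn p.1 i j Yset)}

/-- The product shift `T̄(x,z) = (Tx, Tz)`. -/
def shift2 (p : Bin × Bin) : Bin × Bin := (shift p.1, shift p.2)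

/-- The set `A = {(x,z) ∈ P : z_0 = 1}`. -/
def Aset : Set (Bin × Bin) := {p | p ∈ PinSpace ∧ p.2 0 = true}

/-- The first return time to `A`. -/
def retTime (p : Bin × Bin) : ℕ :=
  sInf {k : ℕ | 1 ≤ k ∧ shift2^[k] p ∈ Aset}

/-- The induced (first-return) map `T̄_A`. -/
def inducedMap (p : Bin × Bin) : Bin × Bin := shift2^[retTime p] p

/-- `Q_j`, the set of points of `A` with first return time `j`. -/
def Qset (j : ℕ) : Set (Bin × Bin) := {p | p ∈ Aset ∧ retTime p = j}

/-- `Q_{j,s}` for `1 ≤ s ≤ ⌊log₂ j⌋ - 3`: points of `Q_j` whose initial block of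
length `j` lies in the language of `X_s`; the class `s = 0` collects the blocks
belonging to some `X_{s'}` with `s' ≥ ⌊log₂ j⌋ - 2`. -/
def Qjs (j s : ℕ) : Set (Bin × Bin) :=
  if s = 0 then
    {p | p ∈ Qset j ∧ ∃ s' : ℕ, 1 ≤ s' ∧ Nat.log 2 j - 2 ≤ s' ∧ WordIn p.1 j (Xsub s')}
  else {p | p ∈ Qset j ∧ WordIn p.1 j (Xsub s)}

/-! ### Upper bounds for the entropy of the shift -/

lemma sum_neg_mul_logb_le {F : Type*} [Fintype F] {p q : F → ℝ} {C : ℝ} (hp : ∀ a, 0 ≤ p a)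
    (hp1 : ∑ a, p a = 1) (hq : ∀ a, 0 < q a) (hC : ∑ a, q a ≤ C) :
    ∑ a, -(p a * logb 2 (p a)) ≤ ∑ a, p a * (-logb 2 (q a)) + logb 2 C := by
  have hne : Nonempty F := by
    by_contra h
    rw [not_nonempty_iff] at h
    simp at hp1
  have hC0 : 0 < C := (Finset.sum_pos (fun a _ => hq a) Finset.univ_nonempty).trans_le hC
  have hlog2 : 0 < Real.log 2 := Real.log_pos one_lt_two
  have key : ∀ a, -(p a * Real.log (p a)) + p a * Real.log (q a) - p a * Real.log C
      ≤ q a / C - p a := by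
    intro a
    rcases (hp a).eq_or_lt with h | h
    · rw [← h]
      simpa using (div_pos (hq a) hC0).le
    · have h1 := Real.log_le_sub_one_of_pos (div_pos (hq a) (mul_pos h hC0))
      rw [Real.log_div (hq a).ne' (mul_pos h hC0).ne', Real.log_mul h.ne' hC0.ne'] at h1
      have h2 := mul_le_mul_of_nonneg_left h1 h.le
      have h3 : p a * (q a / (p a * C) - 1) = q a / C - p a := by
        field_simp
      rw [h3] at h2
      linarith
  have hs := Finset.sum_le_sum fun a (_ : a ∈ Finset.univ) => key a
  rw [Finset.sum_sub_distrib, Finset.sum_sub_distrib, Finset.sum_add_distrib, ← Finset.sum_mul,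
    ← Finset.sum_div, hp1] at hs
  have h4 : (∑ a, q a) / C ≤ 1 := (div_le_one hC0).2 hC
  have h5 : ∑ a, -(p a * Real.log (p a)) + ∑ a, p a * Real.log (q a) ≤ Real.log C := by
    linarith
  have h6 := div_le_div_of_nonneg_right h5 hlog2.le
  rw [add_div, Finset.sum_div, Finset.sum_div] at h6
  simp only [Real.logb, mul_neg, Finset.sum_neg_distrib, mul_div_assoc, neg_div] at h6 ⊢
  linarith

lemma entOfObs_le_integral {X F : Type*} [MeasurableSpace X] [Fintype F] [MeasurableSpace F]
    [MeasurableSingletonClass F] {μ : Measure X} [IsProbabilityMeasure μ] {f : X → F}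
    (hf : Measurable f) {q : F → ℝ} {C : ℝ} (hq : ∀ a, 0 < q a) (hC : ∑ a, q a ≤ C) :
    entOfObs μ f ≤ ∫ x, -logb 2 (q (f x)) ∂μ + logb 2 C := by
  have : IsProbabilityMeasure (μ.map f) := Measure.isProbabilityMeasure_map hf.aemeasurable
  have hreal : ∀ a, (μ (f ⁻¹' {a})).toReal = (μ.map f).real {a} := fun a => by
    rw [Measure.real, Measure.map_apply hf (measurableSet_singleton a)]
  have hint : ∀ G : F → ℝ, ∫ x, G (f x) ∂μ = ∑ a, (μ.map f).real {a} * G a := by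
    intro G
    rw [← integral_map (f := G) hf.aemeasurable
      (measurable_of_finite G).aestronglyMeasurable, integral_fintype .of_finite]
    simp
  have h1 : ∑ a, (μ.map f).real {a} = 1 := by
    rw [← mul_one (∑ a, _), Finset.sum_mul, ← hint fun _ => 1]
    simp
  have h2 := hint fun a => -logb 2 (q a)
  rw [h2]
  simp only [entOfObs, hreal]
  exact sum_neg_mul_logb_le (fun a => measureReal_nonneg) h1 hq hC

lemma entOfObs_nonneg {X F : Type*} [MeasurableSpace X] [Fintype F] (μ : Measure X)
    [IsProbabilityMeasure μ] (f : X → F) : 0 ≤ entOfObs μ f := by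
  refine Finset.sum_nonneg fun a _ => ?_
  have h1 : (μ (f ⁻¹' {a})).toReal ≤ 1 := by
    simpa using ENNReal.toReal_mono ENNReal.one_ne_top (prob_le_one (μ := μ) (s := f ⁻¹' {a}))
  have h2 : logb 2 (μ (f ⁻¹' {a})).toReal ≤ 0 :=
    Real.logb_nonpos one_lt_two ENNReal.toReal_nonneg h1
  nlinarith [ENNReal.toReal_nonneg (a := μ (f ⁻¹' {a}))]

lemma entOfObs_comp {X F : Type*} [MeasurableSpace X] [Fintype F] [MeasurableSpace F]
    [MeasurableSingletonClass F] {μ : Measure X} {T : X → X} (hT : MeasurePreserving T μ μ)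
    {f : X → F} (hf : Measurable f) : entOfObs μ (fun x => f (T x)) = entOfObs μ f := by
  have : ∀ a, μ ((fun x => f (T x)) ⁻¹' {a}) = μ (f ⁻¹' {a}) := fun a =>
    hT.measure_preimage (hf (measurableSet_singleton a)).nullMeasurableSet
  simp only [entOfObs, this]

lemma entObsT_le {X F : Type*} [MeasurableSpace X] [Fintype F] (T : X → X) (μ : Measure X)
    [IsProbabilityMeasure μ] (f : X → F) (n : ℕ) :
    entObsT T μ f ≤ entOfObs μ (fun x => fun i : Fin (n + 1) => f (T^[(i : ℕ)] x)) / (n + 1) :=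
  ciInf_le ⟨0, by rintro _ ⟨n, rfl⟩; exact div_nonneg (entOfObs_nonneg _ _) (by positivity)⟩ n

lemma measurable_shift : Measurable shift :=
  measurable_pi_lambda _ fun n => measurable_pi_apply (n + 1)

lemma iterate_shift (n : ℕ) (x : Bin) (m : ℤ) : shift^[n] x m = x (m + n) := by
  induction n generalizing x m with
  | zero => simp
  | succ n ih =>
    rw [Function.iterate_succ_apply', shift, ih]
    congr 1
    push_cast
    ring

/-- The word `x_0 ⋯ x_{N-1}`. -/
def word (x : Bin) (N : ℕ) : Fin N → Bool := fun i => x ((i : ℕ) : ℤ)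

/-- A point of the full shift whose coordinates `0, …, N-1` spell the word `w`. -/
def wordExt {N : ℕ} (w : Fin N → Bool) : Bin :=
  fun m => if h : m.toNat < N then w ⟨m.toNat, h⟩ else false

lemma wordExt_word {N : ℕ} (x : Bin) {m : ℤ} (h0 : 0 ≤ m) (h1 : m < N) :
    wordExt (word x N) m = x m := by
  have h : m.toNat < N := by omega
  simp [wordExt, word, h, h0]

lemma word_wordExt {N : ℕ} (w : Fin N → Bool) : word (wordExt w) N = w := by
  ext i
  simp [wordExt, word]

lemma exists_window_approx (μ : Measure Bin) [IsProbabilityMeasure μ] {k : ℕ} {f : Bin → Fin k}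
    (hf : Measurable f) {η : ℝ} (hη : 0 < η) :
    ∃ (M : ℕ) (g : Bin → Fin k), Measurable g ∧
      (∀ x y : Bin, (∀ m : ℤ, -M ≤ m → m ≤ M → x m = y m) → g x = g y) ∧
      μ.real {x | f x ≠ g x} ≤ η := by
  classical
  have hk : 0 < k := (Nat.zero_le _).trans_lt (f (fun _ => false)).2
  have hd := Measure.MeasureDense.of_generateFrom_isSetAlgebra_finite (μ := μ)
    (isSetAlgebra_measurableCylinders (α := fun _ : ℤ => Bool)) generateFrom_measurableCylinders.symm
  have hη' : 0 < η / k := by positivity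
  choose S hS hμS using fun a : Fin k =>
    hd.approx (f ⁻¹' {a}) (hf (measurableSet_singleton a)) (measure_ne_top _ _) _ hη'
  have hSm : ∀ a, MeasurableSet (S a) := fun a => MeasurableSet.of_mem_measurableCylinders (hS a)
  choose I B hB hI using fun a => (mem_measurableCylinders (α := fun _ : ℤ => Bool) _).1 (hS a)
  let M : ℕ := ∑ a, ∑ i ∈ I a, i.natAbs
  have hM : ∀ a, ∀ i ∈ I a, -(M : ℤ) ≤ i ∧ i ≤ M := by
    intro a i hi
    have h1 : i.natAbs ≤ ∑ i ∈ I a, i.natAbs :=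
      Finset.single_le_sum (f := fun i : ℤ => i.natAbs) (fun _ _ => Nat.zero_le _) hi
    have h2 : ∑ i ∈ I a, i.natAbs ≤ M :=
      Finset.single_le_sum (f := fun a => ∑ i ∈ I a, i.natAbs) (fun _ _ => Nat.zero_le _)
        (Finset.mem_univ a)
    omega
  have hdep : ∀ x y : Bin, (∀ m : ℤ, -M ≤ m → m ≤ M → x m = y m) → ∀ a, x ∈ S a ↔ y ∈ S a := by
    intro x y hxy a
    rw [hI a, mem_cylinder, mem_cylinder]
    have : (I a).restrict x = (I a).restrict y := by
      ext i
      exact hxy i (hM a i i.2).1 (hM a i i.2).2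
    rw [this]
  let c : Finset (Fin k) → Fin k := fun s => if h : s.Nonempty then s.min' h else ⟨0, hk⟩
  let ind : Bin → Finset (Fin k) := fun x => Finset.univ.filter fun a => x ∈ S a
  refine ⟨M, fun x => c (ind x), ?_, ?_, ?_⟩
  · have hpi : Measurable fun x : Bin => fun a : Fin k => decide (x ∈ S a) :=
      measurable_pi_lambda _ fun a => measurable_to_bool (by
        have : (fun x => decide (x ∈ S a)) ⁻¹' {true} = S a := by ext; simp
        rw [this]; exact hSm a)
    have := (measurable_of_finite fun v : Fin k → Bool =>
      c (Finset.univ.filter fun a => v a = true)).comp hpi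
    simpa [Function.comp_def] using this
  · intro x y hxy
    have : ind x = ind y := by
      ext a
      simp [ind, hdep x y hxy a]
    simp only [this]
  · have hsub : {x | f x ≠ c (ind x)} ⊆ ⋃ a, symmDiff (f ⁻¹' {a}) (S a) := by
      intro x hx
      by_contra hcon
      simp only [Set.mem_iUnion, not_exists, Set.mem_symmDiff, Set.mem_preimage,
        Set.mem_singleton_iff] at hcon
      have : ind x = {f x} := by
        ext a
        have := hcon a
        simp only [ind, Finset.mem_filter, Finset.mem_univ, true_and, Finset.mem_singleton]
        tauto
      apply hx
      simp [this, c]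
    calc μ.real {x | f x ≠ c (ind x)} ≤ μ.real (⋃ a, symmDiff (f ⁻¹' {a}) (S a)) :=
          measureReal_mono hsub
      _ ≤ ∑ a, μ.real (symmDiff (f ⁻¹' {a}) (S a)) := measureReal_iUnion_fintype_le _
      _ ≤ ∑ _a : Fin k, η / k := Finset.sum_le_sum fun a _ =>
          ENNReal.toReal_le_of_le_ofReal hη'.le (hμS a).le
      _ = η := by simp; field_simp

lemma integral_comp_iterate {X : Type*} [MeasurableSpace X] {μ : Measure X} {T : X → X}
    (hT : MeasurePreserving T μ μ) {F : X → ℝ} (hF : Integrable F μ) (i : ℕ) :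
    Integrable (fun x => F (T^[i] x)) μ ∧ ∫ x, F (T^[i] x) ∂μ = ∫ x, F x ∂μ := by
  have h := hT.iterate i
  refine ⟨h.integrable_comp_of_integrable hF, ?_⟩
  have h1 := integral_map (μ := μ) (φ := T^[i]) (f := F) h.measurable.aemeasurable
    (by rw [h.map_eq]; exact hF.aestronglyMeasurable)
  rw [← h1, h.map_eq]

lemma tendsto_logb_mul_pow_div (C D : ℝ) (hC : 0 < C) (M : ℕ) :
    Tendsto (fun n : ℕ => (logb 2 (C * ((n + 1 + 2 * M : ℕ) : ℝ) ^ 4) - (n + 1 + 2 * M : ℕ) * D)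
      / ((n : ℝ) + 1)) atTop (𝓝 (-D)) := by
  have hcast : Tendsto (fun n : ℕ => (n : ℝ) + 1) atTop atTop :=
    tendsto_atTop_add_const_right _ _ tendsto_natCast_atTop_atTop
  have hcastM : Tendsto (fun n : ℕ => (n : ℝ) + 1 + 2 * M) atTop atTop :=
    tendsto_atTop_add_const_right _ _ hcast
  have hinv : Tendsto (fun n : ℕ => ((n : ℝ) + 1)⁻¹) atTop (𝓝 0) := hcast.inv_tendsto_atTop
  have hratio : Tendsto (fun n : ℕ => ((n : ℝ) + 1 + 2 * M) / (n + 1)) atTop (𝓝 1) := by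
    have : Tendsto (fun n : ℕ => 1 + 2 * M * ((n : ℝ) + 1)⁻¹) atTop (𝓝 (1 + 2 * M * 0)) :=
      (hinv.const_mul _).const_add 1
    simp only [mul_zero, add_zero] at this
    refine this.congr fun n => ?_
    field_simp
  have hlog : Tendsto (fun n : ℕ => Real.log ((n : ℝ) + 1 + 2 * M) / (n + 1 + 2 * M)) atTop
      (𝓝 0) :=
    (Real.isLittleO_log_id_atTop.tendsto_div_nhds_zero).comp hcastM
  have hmain : Tendsto (fun n : ℕ => (Real.log C / Real.log 2) * ((n : ℝ) + 1)⁻¹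
      + 4 / Real.log 2 * (Real.log ((n : ℝ) + 1 + 2 * M) / (n + 1 + 2 * M)
        * (((n : ℝ) + 1 + 2 * M) / (n + 1))) - ((n : ℝ) + 1 + 2 * M) / (n + 1) * D) atTop
      (𝓝 ((Real.log C / Real.log 2) * 0 + 4 / Real.log 2 * (0 * 1) - 1 * D)) :=
    ((hinv.const_mul _).add ((hlog.mul hratio).const_mul _)).sub (hratio.mul_const D)
  simp only [mul_zero, zero_mul, one_mul, zero_add, zero_sub] at hmain
  refine hmain.congr fun n => ?_
  have hpos : (0 : ℝ) < (n : ℝ) + 1 + 2 * M := by positivity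
  have hpos' : (0 : ℝ) < (n : ℝ) + 1 := by positivity
  push_cast
  rw [Real.logb, Real.log_mul hC.ne' (by positivity), Real.log_pow]
  have := Real.log_pos one_lt_two
  push_cast
  field_simp

lemma sum_prod_le_pow {ι A : Type*} [Fintype ι] [DecidableEq ι] [Fintype A] {r : ι → A → ℝ} {c : ℝ}
    (hr : ∀ i a, 0 ≤ r i a) (hc : ∀ i, ∑ a, r i a ≤ c) :
    ∑ v : ι → A, ∏ i, r i (v i) ≤ c ^ Fintype.card ι := by
  calc ∑ v : ι → A, ∏ i, r i (v i) = ∏ i, ∑ a, r i a := by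
        rw [Finset.prod_univ_sum, Fintype.piFinset_univ]
    _ ≤ ∏ _i : ι, c :=
        Finset.prod_le_prod (fun i _ => Finset.sum_nonneg fun a _ => hr i a) fun i _ => hc i
    _ = c ^ Fintype.card ι := by simp

lemma entObsT_le_of_window {μ : Measure Bin} (hμ : InvProb shift μ) {F : Bin → ℝ}
    (hF : Integrable F μ) {C : ℝ} (hC : 0 < C) {q : ∀ N, (Fin N → Bool) → ℝ}
    (hqF : ∀ N, 1 ≤ N → ∀ x, (2 : ℝ) ^ (∑ i ∈ Finset.range N, F (shift^[i] x)) ≤ q N (word x N))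
    (hqC : ∀ N, 1 ≤ N → ∑ w, q N w ≤ C * (N : ℝ) ^ 4)
    {k : ℕ} {f g : Bin → Fin k} (hf : Measurable f) (hg : Measurable g) {M : ℕ}
    (hgM : ∀ x y : Bin, (∀ m : ℤ, -M ≤ m → m ≤ M → x m = y m) → g x = g y) (B n : ℕ) :
    entOfObs μ (fun x => fun i : Fin (n + 1) => f (shift^[(i : ℕ)] x)) ≤
      (n + 1) * (B * μ.real {x | f x ≠ g x}) + (n + 1) * logb 2 (1 + k * (1 / 2) ^ B) +
        (logb 2 (C * ((n + 1 + 2 * M : ℕ) : ℝ) ^ 4) - (n + 1 + 2 * M : ℕ) * ∫ x, F x ∂μ) := by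
  obtain ⟨hprob, hT⟩ := hμ
  set N := n + 1 + 2 * M with hN
  have hN1 : 1 ≤ N := by omega
  let δ : ℝ := (1 / 2) ^ B
  have hδ : 0 < δ := by positivity
  let r : Fin k → Fin k → ℝ := fun a b => if a = b then 1 else δ
  have hr : ∀ a b, 0 < r a b := fun a b => by
    simp only [r]; split_ifs <;> [exact one_pos; exact hδ]
  have hrsum : ∀ b, ∑ a, r a b ≤ 1 + k * δ := by
    intro b
    calc ∑ a, r a b ≤ ∑ a, ((if a = b then 1 else 0) + δ) := by
          refine Finset.sum_le_sum fun a _ => ?_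
          simp only [r]; split_ifs <;> linarith
      _ = 1 + k * δ := by simp [Finset.sum_add_distrib]
  let ind : Bin → ℝ := Set.indicator {x | f x ≠ g x} fun _ => 1
  have hfg : MeasurableSet {x | f x ≠ g x} := (measurableSet_eq_fun hf hg).compl
  have hind : Integrable ind μ := (integrable_const 1).indicator hfg
  have hind' : ∫ x, ind x ∂μ = μ.real {x | f x ≠ g x} := by
    simp [ind, integral_indicator hfg]
  have hrlog : ∀ x, -logb 2 (r (f x) (g x)) = B * ind x := by
    intro x
    by_cases h : f x = g x
    · simp [r, ind, h]
    · have h2 : logb 2 (2 ^ B) = (B : ℝ) := by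
        rw [Real.logb_pow]
        simp
      simp [r, ind, h, δ, h2]
  have hq0 : ∀ w, 0 < q N w := fun w => by
    have := hqF N hN1 (wordExt w)
    rw [word_wordExt] at this
    exact (Real.rpow_pos_of_pos two_pos _).trans_le this
  let Q : (Fin (n + 1) → Fin k) → ℝ := fun a =>
    ∑ w : Fin N → Bool, q N w * ∏ i, r (a i) (g (shift^[(i : ℕ) + M] (wordExt w)))
  have hterm : ∀ (a : Fin (n + 1) → Fin k) w, 0 < q N w * ∏ i : Fin (n + 1), r (a i) (g (shift^[(i : ℕ) + M] (wordExt w))) :=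
    fun a w => mul_pos (hq0 w) (Finset.prod_pos fun i _ => hr _ _)
  have hQ0 : ∀ a, 0 < Q a := fun a =>
    Finset.sum_pos (fun w _ => hterm a w) Finset.univ_nonempty
  have hQsum : ∑ a, Q a ≤ C * (N : ℝ) ^ 4 * (1 + k * δ) ^ (n + 1) := by
    simp only [Q]
    rw [Finset.sum_comm]
    calc _ ≤ ∑ w : Fin N → Bool, q N w * (1 + k * δ) ^ (n + 1) := by
          refine Finset.sum_le_sum fun w _ => ?_
          rw [← Finset.mul_sum]
          refine mul_le_mul_of_nonneg_left ?_ (hq0 w).le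
          simpa only [Fintype.card_fin] using sum_prod_le_pow
            (r := fun (i : Fin (n + 1)) a => r a (g (shift^[(i : ℕ) + M] (wordExt w))))
            (fun i a => (hr _ _).le) fun i => hrsum _
      _ ≤ _ := by
          rw [← Finset.sum_mul]
          exact mul_le_mul_of_nonneg_right (hqC N hN1) (by positivity)
  let fM : Bin → Fin (n + 1) → Fin k := fun x i => f (shift^[(i : ℕ)] (shift^[M] x))
  have hfn : Measurable fun x => fun i : Fin (n + 1) => f (shift^[(i : ℕ)] x) :=
    measurable_pi_lambda _ fun i => hf.comp (measurable_shift.iterate i)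
  have hfM : Measurable fM := hfn.comp (measurable_shift.iterate M)
  have hpt : ∀ x, -logb 2 (Q (fM x)) ≤
      -(∑ i ∈ Finset.range N, F (shift^[i] x)) + ∑ i : Fin (n + 1), B * ind (shift^[(i : ℕ) + M] x) := by
    intro x
    have hgx : ∀ i : Fin (n + 1), g (shift^[(i : ℕ) + M] (wordExt (word x N))) =
        g (shift^[(i : ℕ) + M] x) := by
      intro i
      refine hgM _ _ fun m h1 h2 => ?_
      rw [iterate_shift, iterate_shift]
      have := i.2
      exact wordExt_word x (by push_cast; omega) (by push_cast; omega)
    have h1 : q N (word x N) * ∏ i : Fin (n + 1), r (fM x i) (g (shift^[(i : ℕ) + M] x)) ≤ Q (fM x) := by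
      have := Finset.single_le_sum (f := fun w : Fin N → Bool =>
        q N w * ∏ i, r (fM x i) (g (shift^[(i : ℕ) + M] (wordExt w))))
        (fun w _ => (hterm (fM x) w).le) (Finset.mem_univ (word x N))
      simpa only [hgx] using this
    have h2 := Real.logb_le_logb_of_le one_lt_two
      (mul_pos (hq0 (word x N)) (Finset.prod_pos fun i _ => hr _ _)) h1
    rw [Real.logb_mul (hq0 _).ne' (Finset.prod_pos fun i _ => hr _ _).ne',
      Real.logb_prod _ _ fun i _ => (hr _ _).ne'] at h2
    have h3 := Real.logb_le_logb_of_le one_lt_two (Real.rpow_pos_of_pos two_pos _) (hqF N hN1 x)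
    rw [Real.logb_rpow two_pos (by norm_num)] at h3
    have h4 : ∑ i : Fin (n + 1), B * ind (shift^[(i : ℕ) + M] x) =
        -∑ i : Fin (n + 1), logb 2 (r (fM x i) (g (shift^[(i : ℕ) + M] x))) := by
      rw [← Finset.sum_neg_distrib]
      refine Finset.sum_congr rfl fun i _ => ?_
      rw [← hrlog, Function.iterate_add_apply]
    rw [h4]
    linarith
  have hent : entOfObs μ fM = entOfObs μ (fun x => fun i : Fin (n + 1) => f (shift^[(i : ℕ)] x)) :=
    entOfObs_comp (hT.iterate M) hfn
  have hbound := entOfObs_le_integral (μ := μ) hfM hQ0 hQsum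
  rw [hent, integral_neg] at hbound
  have hint1 : Integrable (fun x => -(∑ i ∈ Finset.range N, F (shift^[i] x))) μ :=
    (integrable_finsetSum _ fun i _ => (integral_comp_iterate hT hF i).1).neg
  have hint2 : ∀ i : Fin (n + 1), Integrable (fun x => B * ind (shift^[(i : ℕ) + M] x)) μ := fun i =>
    (integral_comp_iterate hT hind _).1.const_mul _
  have hint3 : Integrable (fun x => -logb 2 (Q (fM x))) μ := by
    have : IsProbabilityMeasure (μ.map fM) := Measure.isProbabilityMeasure_map hfM.aemeasurable
    exact (Integrable.of_finite (μ := μ.map fM) (f := fun a => -logb 2 (Q a))).comp_measurable hfM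
  have hmono := integral_mono hint3 (hint1.add (integrable_finsetSum Finset.univ fun i _ => hint2 i)) hpt
  simp only [Pi.add_apply] at hmono
  rw [integral_add hint1 (integrable_finsetSum _ fun i _ => hint2 i), integral_neg, integral_neg,
    integral_finsetSum _ fun i _ => (integral_comp_iterate hT hF i).1,
    integral_finsetSum _ fun i _ => hint2 i] at hmono
  have e1 : ∀ i : ℕ, ∫ x, F (shift^[i] x) ∂μ = ∫ x, F x ∂μ := fun i =>
    (integral_comp_iterate hT hF i).2
  have e2 : ∀ i : Fin (n + 1), ∫ x, B * ind (shift^[(i : ℕ) + M] x) ∂μ =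
      B * μ.real {x | f x ≠ g x} := fun i => by
    rw [integral_const_mul, (integral_comp_iterate hT hind _).2, hind']
  simp only [e1, e2, Finset.sum_const, Finset.card_range, Finset.card_univ, Fintype.card_fin,
    nsmul_eq_mul] at hmono
  have hN0 : (0 : ℝ) < N := by exact_mod_cast hN1
  rw [Real.logb_mul (by positivity) (by positivity), Real.logb_pow] at hbound
  push_cast at hmono hbound ⊢
  linarith

theorem entObsT_le_neg_integral {μ : Measure Bin} (hμ : InvProb shift μ) {F : Bin → ℝ}
    (hF : Integrable F μ) {C : ℝ} (hC : 0 < C) {q : ∀ N, (Fin N → Bool) → ℝ}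
    (hqF : ∀ N, 1 ≤ N → ∀ x, (2 : ℝ) ^ (∑ i ∈ Finset.range N, F (shift^[i] x)) ≤ q N (word x N))
    (hqC : ∀ N, 1 ≤ N → ∑ w, q N w ≤ C * (N : ℝ) ^ 4)
    {k : ℕ} {f : Bin → Fin k} (hf : Measurable f) : entObsT shift μ f ≤ -∫ x, F x ∂μ := by
  have hprob := hμ.1
  have step : ∀ B : ℕ, entObsT shift μ f ≤
      1 / ((B : ℝ) + 1) + logb 2 (1 + k * (1 / 2) ^ B) + -∫ x, F x ∂μ := by
    intro B
    obtain ⟨M, g, hg, hgM, hfg⟩ := exists_window_approx μ hf (η := 1 / ((B : ℝ) + 1) ^ 2)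
      (by positivity)
    have hlim := (tendsto_logb_mul_pow_div C (∫ x, F x ∂μ) hC M).const_add
      (1 / ((B : ℝ) + 1) + logb 2 (1 + k * (1 / 2) ^ B))
    refine ge_of_tendsto' hlim fun n => ?_
    refine (entObsT_le shift μ f n).trans ?_
    have hw := entObsT_le_of_window hμ hF hC hqF hqC hf hg hgM B n
    have hn : (0 : ℝ) < n + 1 := by positivity
    have hB : B * μ.real {x | f x ≠ g x} ≤ 1 / ((B : ℝ) + 1) := by
      calc B * μ.real {x | f x ≠ g x} ≤ (B + 1) * (1 / ((B : ℝ) + 1) ^ 2) :=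
            mul_le_mul (by linarith) hfg measureReal_nonneg (by positivity)
        _ = _ := by field_simp
    rw [div_le_iff₀ hn, add_mul, div_mul_cancel₀ _ hn.ne']
    have := mul_le_mul_of_nonneg_left hB hn.le
    linarith
  have h1 : Tendsto (fun B : ℕ => 1 / ((B : ℝ) + 1)) atTop (𝓝 0) :=
    tendsto_one_div_add_atTop_nhds_zero_nat
  have h2 : Tendsto (fun B : ℕ => logb 2 (1 + (k : ℝ) * (1 / 2) ^ B)) atTop (𝓝 0) := by
    have h3 : Tendsto (fun B : ℕ => 1 + (k : ℝ) * (1 / 2) ^ B) atTop (𝓝 (1 + k * 0)) :=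
      ((tendsto_pow_atTop_nhds_zero_of_lt_one (by norm_num) (by norm_num)).const_mul _).const_add 1
    have h4 := (Real.continuousAt_logb (b := 2) (x := 1 + (k : ℝ) * 0) (by simp)).tendsto.comp h3
    simpa [Function.comp_def] using h4
  have h5 := (h1.add h2).add_const (-∫ x, F x ∂μ)
  simp only [zero_add] at h5
  exact ge_of_tendsto' h5 step

/-! ### Weights on words built by renewal -/

lemma word_word {x : Bin} {j N : ℕ} (h : j ≤ N) : word (wordExt (word x N)) j = word x j := by
  ext i
  have := i.2
  exact wordExt_word x (by omega) (by omega)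

lemma word_shift_word (x : Bin) (j M : ℕ) :
    word (shift^[j] (wordExt (word x (j + M)))) M = word (shift^[j] x) M := by
  ext i
  have := i.2
  simp only [word, iterate_shift]
  exact wordExt_word x (by omega) (by push_cast; omega)

lemma sum_head_mul_tail (j M : ℕ) (A : (Fin j → Bool) → ℝ) (B : (Fin M → Bool) → ℝ) :
    ∑ w : Fin (j + M) → Bool, A (word (wordExt w) j) * B (word (shift^[j] (wordExt w)) M) =
      (∑ w, A w) * ∑ w, B w := by
  rw [Finset.sum_mul_sum, ← Fintype.sum_prod_type', ← (Fin.appendEquiv j M).sum_comp]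
  refine Finset.sum_congr rfl fun p _ => ?_
  have h1 : word (wordExt (Fin.append p.1 p.2)) j = p.1 := by
    ext i
    have hi : (i : ℕ) < j + M := by omega
    have : (⟨i, hi⟩ : Fin (j + M)) = Fin.castAdd M i := rfl
    simp [word, wordExt, hi, this]
  have h2 : word (shift^[j] (wordExt (Fin.append p.1 p.2))) M = p.2 := by
    ext i
    have hi : (i : ℕ) + j < j + M := by omega
    have h3 : ((i : ℤ) + j).toNat = i + j := by omega
    have : (⟨(i : ℕ) + j, hi⟩ : Fin (j + M)) = Fin.natAdd j i := by
      ext; simp [add_comm]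
    simp [word, iterate_shift, wordExt, hi, h3, this]
  simp only [Fin.appendEquiv, Equiv.coe_fn_mk, h1, h2]

theorem exists_renewal_weight {u u' : ∀ N, (Fin N → Bool) → ℝ} (hu : ∀ N w, 0 ≤ u N w)
    (hu' : ∀ N w, 0 ≤ u' N w) {F : Bin → ℝ} {C : ℝ} (hC : 0 ≤ C)
    (h1 : ∀ N, ∑ j ∈ Finset.Ico 1 N, ∑ w, u j w ≤ 1)
    (h2 : ∀ N, 1 ≤ N → ∑ w, u' N w ≤ C * (N : ℝ) ^ 3)
    (h : ∀ x N, 1 ≤ N → (2 : ℝ) ^ (∑ i ∈ Finset.range N, F (shift^[i] x)) ≤ u' N (word x N) ∨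
      ∃ j, 1 ≤ j ∧ j < N ∧ (2 : ℝ) ^ (∑ i ∈ Finset.range j, F (shift^[i] x)) ≤ u j (word x j))
    (N : ℕ) (hN : 1 ≤ N) :
    ∃ q : (Fin N → Bool) → ℝ, (∀ w, 0 ≤ q w) ∧ ∑ w, q w ≤ C * (N : ℝ) ^ 4 ∧
      ∀ x, (2 : ℝ) ^ (∑ i ∈ Finset.range N, F (shift^[i] x)) ≤ q (word x N) := by
  induction N using Nat.strong_induction_on with
  | _ N ih =>
  choose! q hq0 hqC hqF using ih
  have hterm : ∀ j ∈ Finset.Ico 1 N, ∀ w : Fin N → Bool, 0 ≤ u j (word (wordExt w) j) *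
      q (N - j) (word (shift^[j] (wordExt w)) (N - j)) := by
    intro j hj w
    rw [Finset.mem_Ico] at hj
    exact mul_nonneg (hu _ _) (hq0 _ (by omega) (by omega) _)
  refine ⟨fun w => u' N w + ∑ j ∈ Finset.Ico 1 N, u j (word (wordExt w) j) *
    q (N - j) (word (shift^[j] (wordExt w)) (N - j)), fun w =>
      add_nonneg (hu' _ _) (Finset.sum_nonneg fun j hj => hterm j hj w), ?_, ?_⟩
  · rw [Finset.sum_add_distrib, Finset.sum_comm]
    have hj : ∀ j ∈ Finset.Ico 1 N, ∑ w : Fin N → Bool, u j (word (wordExt w) j) *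
        q (N - j) (word (shift^[j] (wordExt w)) (N - j)) ≤
        (∑ w, u j w) * (C * ((N : ℝ) - 1) ^ 4) := by
      intro j hj
      rw [Finset.mem_Ico] at hj
      obtain ⟨M, rfl⟩ := Nat.exists_eq_add_of_le hj.2.le
      rw [Nat.add_sub_cancel_left, sum_head_mul_tail]
      refine mul_le_mul_of_nonneg_left ?_ (Finset.sum_nonneg fun w _ => hu _ _)
      refine (hqC M (by omega) (by omega)).trans (mul_le_mul_of_nonneg_left ?_ hC)
      refine pow_le_pow_left₀ (Nat.cast_nonneg _) ?_ _
      have : (1 : ℝ) ≤ j := by exact_mod_cast hj.1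
      push_cast
      linarith
    have hN' : (1 : ℝ) ≤ N := by exact_mod_cast hN
    calc _ ≤ C * (N : ℝ) ^ 3 + ∑ j ∈ Finset.Ico 1 N, (∑ w, u j w) * (C * ((N : ℝ) - 1) ^ 4) :=
          add_le_add (h2 N hN) (Finset.sum_le_sum hj)
      _ ≤ C * (N : ℝ) ^ 3 + 1 * (C * ((N : ℝ) - 1) ^ 4) := by
          rw [← Finset.sum_mul]
          exact add_le_add_right (mul_le_mul_of_nonneg_right (h1 N) (by positivity)) _
      _ = C * ((N : ℝ) ^ 3 + (N - 1) * (N - 1) ^ 3) := by ring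
      _ ≤ C * ((N : ℝ) ^ 3 + (N - 1) * N ^ 3) := by
          refine mul_le_mul_of_nonneg_left (add_le_add_right (mul_le_mul_of_nonneg_left ?_ ?_) _) hC
          · exact pow_le_pow_left₀ (by linarith) (by linarith) _
          · linarith
      _ = C * (N : ℝ) ^ 4 := by ring
  · intro x
    rcases h x N hN with h3 | ⟨j, hj1, hjN, h3⟩
    · exact h3.trans (le_add_of_nonneg_right (Finset.sum_nonneg fun j hj => hterm j hj _))
    · have hj : j ∈ Finset.Ico 1 N := Finset.mem_Ico.2 ⟨hj1, hjN⟩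
      have h4 := Finset.single_le_sum (fun j hj => hterm j hj (word x N)) hj
      refine le_trans ?_ (h4.trans (le_add_of_nonneg_left (hu' _ _)))
      obtain ⟨M, rfl⟩ := Nat.exists_eq_add_of_le hjN.le
      rw [Nat.add_sub_cancel_left, word_word (Nat.le_add_right _ _), word_shift_word,
        Finset.sum_range_add, Real.rpow_add two_pos]
      refine mul_le_mul h3 ?_ (Real.rpow_pos_of_pos two_pos _).le (hu _ _)
      have := hqF M (by omega) (by omega) (shift^[j] x)
      simpa only [← Function.iterate_add_apply, add_comm] using this

/-! ### The coded systems -/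

/-- The concatenation of the words of `genWords s` chosen by `a`, with a word starting at `-t`. -/
def code (s : ℕ) (a : ℤ → Bool) (t : ℤ) : Bin :=
  fun m => xor (a ((m + t) / 2 ^ s)) (decide ((m + t) % 2 ^ s = 2 ^ s - 1))

/-- The stretch of `x` on `[l, r)` is part of a concatenation of words of `genWords s`. -/
def IsCodedOn (s : ℕ) (x : Bin) (l r : ℤ) : Prop :=
  ∃ a t, ∀ m, l ≤ m → m < r → x m = code s a t m

lemma code_apply {s : ℕ} (a : ℤ → Bool) {t m e ρ : ℤ} (h : m + t = ρ + 2 ^ s * e) (h0 : 0 ≤ ρ)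
    (h1 : ρ < 2 ^ s) : code s a t m = xor (a e) (decide (ρ = 2 ^ s - 1)) := by
  have := (Int.ediv_emod_unique (a := m + t) (r := ρ) (q := e) (b := 2 ^ s) (by positivity)).2
    ⟨h.symm, h0, h1⟩
  rw [code, this.1, this.2]

lemma code_add (s : ℕ) (a : ℤ → Bool) (t m p : ℤ) : code s a t (m + p) = code s a (t + p) m := by
  simp only [code, show m + p + t = m + (t + p) by ring]

lemma code_add_mul (s : ℕ) (a : ℤ → Bool) (t e : ℤ) :
    code s a (t + 2 ^ s * e) = code s (fun i => a (i + e)) t := by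
  ext m
  have h : (0 : ℤ) < 2 ^ s := by positivity
  rw [code, code, show m + (t + 2 ^ s * e) = m + t + 2 ^ s * e by ring,
    Int.add_mul_ediv_left _ _ h.ne', Int.add_mul_emod_self_left]

lemma exists_code_eq (s : ℕ) (a : ℤ → Bool) (t : ℤ) :
    ∃ b t', 0 ≤ t' ∧ t' < 2 ^ s ∧ code s a t = code s b t' := by
  have h : (0 : ℤ) < 2 ^ s := by positivity
  refine ⟨fun i => a (i + t / 2 ^ s), t % 2 ^ s, Int.emod_nonneg _ h.ne', Int.emod_lt_of_pos _ h, ?_⟩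
  rw [← code_add_mul s a (t % 2 ^ s) (t / 2 ^ s), Int.emod_add_mul_ediv]

lemma IsCodedOn.mono {s : ℕ} {x : Bin} {l r l' r' : ℤ} (h : IsCodedOn s x l r) (hl : l ≤ l')
    (hr : r' ≤ r) : IsCodedOn s x l' r' := by
  obtain ⟨a, t, h⟩ := h
  exact ⟨a, t, fun m h1 h2 => h m (by omega) (by omega)⟩

lemma IsCodedOn.congr {s : ℕ} {x y : Bin} {l r : ℤ} (h : IsCodedOn s x l r)
    (hxy : ∀ m, l ≤ m → m < r → y m = x m) : IsCodedOn s y l r := by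
  obtain ⟨a, t, h⟩ := h
  exact ⟨a, t, fun m h1 h2 => (hxy m h1 h2).trans (h m h1 h2)⟩

lemma IsCodedOn.of_shift {s : ℕ} {x : Bin} {p : ℕ} {l r : ℤ} (h : IsCodedOn s (shift^[p] x) l r) :
    IsCodedOn s x (l + p) (r + p) := by
  obtain ⟨a, t, h⟩ := h
  refine ⟨a, t - p, fun m h1 h2 => ?_⟩
  have := h (m - p) (by omega) (by omega)
  rw [iterate_shift, sub_add_cancel] at this
  rw [this]
  have := code_add s a (t - p) (m - p) p
  rwa [sub_add_cancel, sub_add_cancel, eq_comm] at this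

lemma genWords_get {s : ℕ} {w : List Bool} (hw : w ∈ genWords s) : w.length = 2 ^ s ∧
    ∃ b : Bool, ∀ (i : ℕ) (h : i < w.length), w.get ⟨i, h⟩ = xor b (decide ((i : ℤ) = 2 ^ s - 1)) := by
  have h1 : 1 ≤ 2 ^ s := Nat.one_le_two_pow
  have h2 : ((2 ^ s : ℕ) : ℤ) = 2 ^ s := by push_cast; rfl
  have key : ∀ b : Bool, ∀ w, w = List.replicate (2 ^ s - 1) b ++ [!b] → w.length = 2 ^ s ∧
      ∀ (i : ℕ) (h : i < w.length), w.get ⟨i, h⟩ = xor b (decide ((i : ℤ) = 2 ^ s - 1)) := by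
    rintro b w rfl
    refine ⟨by simp; omega, fun i h => ?_⟩
    simp only [List.length_append, List.length_replicate, List.length_singleton] at h
    simp only [List.get_eq_getElem, List.getElem_append, List.length_replicate]
    split_ifs with h3
    · have : ¬ ((i : ℤ) = 2 ^ s - 1) := by omega
      simp [this]
    · have : (i : ℤ) = 2 ^ s - 1 := by omega
      simp [this]
  rcases hw with hw | hw
  · exact ⟨(key false w hw).1, false, (key false w hw).2⟩
  · exact ⟨(key true w hw).1, true, (key true w hw).2⟩

lemma exists_genWords (s : ℕ) (b : Bool) : ∃ w ∈ genWords s, w.length = 2 ^ s ∧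
    ∀ (i : ℕ) (h : i < w.length), w.get ⟨i, h⟩ = xor b (decide ((i : ℤ) = 2 ^ s - 1)) := by
  have h1 : 1 ≤ 2 ^ s := Nat.one_le_two_pow
  have h2 : ((2 ^ s : ℕ) : ℤ) = 2 ^ s := by push_cast; rfl
  refine ⟨List.replicate (2 ^ s - 1) b ++ [!b], by cases b <;> simp [genWords], by simp; omega,
    fun i h => ?_⟩
  simp only [List.length_append, List.length_replicate, List.length_singleton] at h
  simp only [List.get_eq_getElem, List.getElem_append, List.length_replicate]
  split_ifs with h3
  · have : ¬ ((i : ℤ) = 2 ^ s - 1) := by omega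
    simp [this]
  · have : (i : ℤ) = 2 ^ s - 1 := by omega
    simp [this]

lemma isFreeConcat_code (s : ℕ) (a : ℤ → Bool) (t : ℤ) : IsFreeConcat (genWords s) (code s a t) := by
  have h0 : (0 : ℤ) < 2 ^ s := by positivity
  have h2 : ((2 ^ s : ℕ) : ℤ) = 2 ^ s := by push_cast; rfl
  refine ⟨fun k => 2 ^ s * k - t, fun k l h => ?_, fun N => ⟨|N| + |t| + 1, ?_⟩,
    fun N => ⟨-(|N| + |t| + 1), ?_⟩, fun k => ?_⟩
  · have := mul_lt_mul_of_pos_left h h0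
    simp only; linarith
  · have h3 : 1 * (|N| + |t| + 1) ≤ 2 ^ s * (|N| + |t| + 1) :=
      mul_le_mul_of_nonneg_right (by omega) (by positivity)
    have := le_abs_self N
    have := le_abs_self t
    linarith
  · have h3 : 1 * (|N| + |t| + 1) ≤ 2 ^ s * (|N| + |t| + 1) :=
      mul_le_mul_of_nonneg_right (by omega) (by positivity)
    have := neg_abs_le N
    have := neg_abs_le t
    linarith
  · obtain ⟨w, hw, hl, hg⟩ := exists_genWords s (a k)
    refine ⟨w, hw, by rw [hl, h2]; ring, fun i h => ?_⟩
    rw [hg, code_apply a (ρ := i) (e := k) (by ring) (by omega) (by omega)]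

lemma IsFreeConcat.exists_code {s : ℕ} {x : Bin} (h : IsFreeConcat (genWords s) x) :
    ∃ a t, x = code s a t := by
  obtain ⟨t, -, -, -, hw⟩ := h
  have h0 : (0 : ℤ) < 2 ^ s := by positivity
  choose w hwm hwt hwx using hw
  choose hl b hb using fun k => genWords_get (hwm k)
  have hstep : ∀ k, t (k + 1) = t k + 2 ^ s := fun k => by
    rw [hwt, hl]; push_cast; rfl
  have ht : ∀ k : ℤ, t k = t 0 + 2 ^ s * k := by
    intro k
    induction k using Int.induction_on with
    | zero => simp
    | succ k ih => rw [hstep, ih]; ring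
    | pred k ih =>
      have := hstep (-(k : ℤ) - 1)
      rw [sub_add_cancel, ih] at this
      linarith
  refine ⟨b, -t 0, funext fun m => ?_⟩
  obtain ⟨i, hi⟩ : ∃ i : ℕ, (i : ℤ) = (m - t 0) % 2 ^ s :=
    ⟨_, Int.toNat_of_nonneg (Int.emod_nonneg _ h0.ne')⟩
  have hi2 : (i : ℤ) < 2 ^ s := hi ▸ Int.emod_lt_of_pos _ h0
  have hil : i < (w ((m - t 0) / 2 ^ s)).length := by
    rw [hl]; exact_mod_cast hi2
  have hdiv := Int.emod_add_mul_ediv (m - t 0) (2 ^ s)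
  have hx := hwx ((m - t 0) / 2 ^ s) i hil
  rw [hb, ht, show t 0 + 2 ^ s * ((m - t 0) / 2 ^ s) + i = m by linarith] at hx
  rw [hx, code_apply b (e := (m - t 0) / 2 ^ s) (ρ := i) (by linarith) (by omega) hi2]

lemma code_mem_Xsub (s : ℕ) (a : ℤ → Bool) (t : ℤ) : code s a t ∈ Xsub s :=
  subset_closure (isFreeConcat_code s a t)

lemma isCodedOn_of_mem {s : ℕ} {z : Bin} (hz : z ∈ Xsub s) (l r : ℤ) : IsCodedOn s z l r := by
  have hopen : IsOpen {y : Bin | ∀ m ∈ Finset.Ico l r, y m = z m} := by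
    have : {y : Bin | ∀ m ∈ Finset.Ico l r, y m = z m} =
        Set.pi (Finset.Ico l r) fun m => {z m} := by ext; simp
    rw [this]
    exact isOpen_set_pi (Finset.finite_toSet _) fun m _ => isOpen_discrete _
  obtain ⟨y, hy, hyc⟩ := mem_closure_iff.1 hz _ hopen fun m _ => rfl
  obtain ⟨a, t, rfl⟩ := IsFreeConcat.exists_code hyc
  exact ⟨a, t, fun m h1 h2 => (hy m (Finset.mem_Ico.2 ⟨h1, h2⟩)).symm⟩

lemma emod_of_code_ne {s : ℕ} {a : ℤ → Bool} {t m : ℤ} (h : code s a t m ≠ code s a t (m + 1)) :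
    2 ^ s - 2 ≤ (m + t) % 2 ^ s := by
  by_contra! hlt
  have h0 : (0 : ℤ) < 2 ^ s := by positivity
  have h1 := Int.emod_nonneg (m + t) h0.ne'
  have h2 := Int.emod_add_mul_ediv (m + t) (2 ^ s)
  refine h ?_
  rw [code_apply a h2.symm h1 (by omega),
    code_apply a (m := m + 1) (ρ := (m + t) % 2 ^ s + 1) (e := (m + t) / 2 ^ s) (by linarith)
      (by omega) (by omega)]
  have e1 : (m + t) % 2 ^ s ≠ 2 ^ s - 1 := by omega
  have e2 : (m + t) % 2 ^ s + 1 ≠ 2 ^ s - 1 := by omega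
  simp [e1, e2]

lemma code_ne_of_emod {s : ℕ} (hs : 1 ≤ s) {a : ℤ → Bool} {t m e : ℤ}
    (h : m + t = 2 ^ s - 2 + 2 ^ s * e) : code s a t m ≠ code s a t (m + 1) := by
  have h0 : (2 : ℤ) ≤ 2 ^ s := le_self_pow₀ one_le_two (by omega)
  rw [code_apply a h (by omega) (by omega),
    code_apply a (m := m + 1) (ρ := 2 ^ s - 1) (e := e) (by linarith) (by omega) (by omega)]
  have : ¬ ((2 : ℤ) ^ s - 2 = 2 ^ s - 1) := by omega
  simp [this]

theorem IsCodedOn.length_le {s s' : ℕ} (hs : 1 ≤ s) (hss : s < s') {x : Bin} {l r : ℤ}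
    (h : IsCodedOn s x l r) (h' : IsCodedOn s' x l r) : r - l ≤ 2 * 2 ^ s := by
  by_contra! hlt
  obtain ⟨a, t, h⟩ := h
  obtain ⟨a', t', h'⟩ := h'
  have hK : (2 : ℤ) ≤ 2 ^ s := le_self_pow₀ one_le_two (by omega)
  have hK' : (2 : ℤ) * 2 ^ s ≤ 2 ^ s' := by
    rw [← pow_succ']; exact pow_le_pow_right₀ one_le_two hss
  obtain ⟨q, hq1, hq2, e, hq⟩ : ∃ q, l ≤ q ∧ q < l + 2 ^ s ∧ ∃ e, q + t = 2 ^ s - 2 + 2 ^ s * e := by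
    refine ⟨l + (2 ^ s - 2 - (l + t)) % 2 ^ s, ?_, ?_, -((2 ^ s - 2 - (l + t)) / 2 ^ s), ?_⟩
    · have := Int.emod_nonneg (2 ^ s - 2 - (l + t)) (b := 2 ^ s) (by omega)
      omega
    · have := Int.emod_lt_of_pos (2 ^ s - 2 - (l + t)) (b := 2 ^ s) (by omega)
      omega
    · have := Int.emod_add_mul_ediv (2 ^ s - 2 - (l + t)) (2 ^ s)
      linarith
  have key : ∀ m e, l ≤ m → m + 1 < r → m + t = 2 ^ s - 2 + 2 ^ s * e →
      2 ^ s' - 2 ≤ (m + t') % 2 ^ s' := by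
    intro m e h1 h2 h3
    have := code_ne_of_emod (a := a) hs h3
    rw [← h m h1 (by omega), ← h (m + 1) (by omega) h2, h' m h1 (by omega),
      h' (m + 1) (by omega) h2] at this
    exact emod_of_code_ne this
  have k1 := key q e hq1 (by omega) hq
  have k2 := key (q + 2 ^ s) (e + 1) (by omega) (by omega) (by linarith)
  have h0' : (0 : ℤ) < 2 ^ s' := by omega
  have h3 := Int.emod_lt_of_pos (q + t') h0'
  have h4 := Int.emod_add_mul_ediv (q + t') (2 ^ s')
  have h5 := ((Int.ediv_emod_unique (a := q + 2 ^ s + t') (r := (q + t') % 2 ^ s' + 2 ^ s - 2 ^ s')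
    (q := (q + t') / 2 ^ s' + 1) (b := 2 ^ s') h0').2 ⟨by linarith, by omega, by omega⟩).2
  omega

lemma IsCodedOn.of_lt {s s' j : ℕ} {x : Bin} (h : IsCodedOn s x 0 j) (hs : j ≤ 2 ^ s)
    (hs' : j < 2 ^ s') : IsCodedOn s' x 0 j := by
  have hs2 : (j : ℤ) ≤ 2 ^ s := by exact_mod_cast hs
  have hs2' : (j : ℤ) < 2 ^ s' := by exact_mod_cast hs'
  obtain ⟨a, t, h⟩ := h
  obtain ⟨b, t, ht0, ht1, hb⟩ := exists_code_eq s a t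
  rw [hb] at h
  refine ⟨b, 2 ^ s' - 1 - min (2 ^ s - 1 - t) j, fun m hm0 hmj => ?_⟩
  rw [h m hm0 hmj]
  by_cases h1 : m ≤ 2 ^ s - 1 - t
  · rw [code_apply b (e := 0) (ρ := m + t) (by ring) (by omega) (by omega),
      code_apply b (e := 0) (ρ := m + (2 ^ s' - 1 - min (2 ^ s - 1 - t) j)) (by ring) (by omega)
        (by omega)]
    congr 2
    rw [eq_iff_iff]
    omega
  · rw [code_apply b (e := 1) (ρ := m + t - 2 ^ s) (by ring) (by omega) (by omega),
      code_apply b (e := 1) (ρ := m + (2 ^ s' - 1 - min (2 ^ s - 1 - t) j) - 2 ^ s') (by ring)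
        (by omega) (by omega)]
    congr 2
    rw [eq_iff_iff]
    omega

open Classical in
lemma card_isCodedOn_le (s j : ℕ) :
    (Finset.univ.filter fun w : Fin j → Bool => IsCodedOn s (wordExt w) 0 j).card ≤
      2 ^ s * 2 ^ (j / 2 ^ s + 2) := by
  have hK : 0 < 2 ^ s := Nat.two_pow_pos s
  let f : Fin (2 ^ s) × (Fin (j / 2 ^ s + 2) → Bool) → (Fin j → Bool) := fun p =>
    word (code s (wordExt p.2) (p.1 : ℕ)) j
  have hsub : (Finset.univ.filter fun w : Fin j → Bool => IsCodedOn s (wordExt w) 0 j) ⊆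
      Finset.univ.image f := by
    intro w hw
    obtain ⟨a, t, h⟩ := (Finset.mem_filter.1 hw).2
    obtain ⟨b, t, ht0, ht1, hb⟩ := exists_code_eq s a t
    rw [hb] at h
    obtain ⟨t, rfl⟩ := Int.eq_ofNat_of_zero_le ht0
    have ht : t < 2 ^ s := by exact_mod_cast ht1
    refine Finset.mem_image.2 ⟨(⟨t, ht⟩, word b _), Finset.mem_univ _, ?_⟩
    rw [← word_wordExt w]
    ext i
    have hi := i.2
    simp only [f, word]
    have hx := h i (by omega) (by omega)
    rw [hx, code, code]
    have hcast : ((i : ℕ) + t : ℤ) / 2 ^ s = (((i : ℕ) + t) / 2 ^ s : ℕ) := by push_cast; rfl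
    have hlt : ((i : ℕ) + t) / 2 ^ s < j / 2 ^ s + 2 := by
      rw [Nat.div_lt_iff_lt_mul hK]
      have := Nat.lt_div_mul_add (a := j) hK
      nlinarith
    have := wordExt_word (N := j / 2 ^ s + 2) b (m := (((i : ℕ) + t) / 2 ^ s : ℕ))
      (Int.natCast_nonneg _)
      (by exact_mod_cast hlt)
    rw [hcast, this]
  refine (Finset.card_le_card hsub).trans (Finset.card_image_le.trans ?_)
  simp

/-! ### The distance to a coded system -/

/-- Some point of `X_s` agrees with `x` on the window `(-m, m)`. -/
def Agrees (s m : ℕ) (x : Bin) : Prop := ∃ z ∈ Xsub s, ∀ i : ℤ, i.natAbs < m → z i = x i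

lemma Agrees.mono {s m m' : ℕ} {x : Bin} (h : Agrees s m x) (hm : m' ≤ m) : Agrees s m' x := by
  obtain ⟨z, hz, h⟩ := h
  exact ⟨z, hz, fun i hi => h i (hi.trans_le hm)⟩

lemma Agrees.isCodedOn {s m : ℕ} {x : Bin} (h : Agrees s m x) : IsCodedOn s x (1 - m) m := by
  obtain ⟨z, hz, h⟩ := h
  exact (isCodedOn_of_mem hz _ _).congr fun i h1 h2 => (h i (by omega)).symm

lemma agrees_one {s : ℕ} (x : Bin) : Agrees s 1 x := by
  refine ⟨code s (fun _ => xor (x 0) (decide ((0 : ℤ) = 2 ^ s - 1))) 0, code_mem_Xsub _ _ _,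
    fun i hi => ?_⟩
  obtain rfl : i = 0 := by omega
  rw [code_apply _ (e := 0) (ρ := 0) (by ring) le_rfl (by positivity)]
  simp

lemma isOpen_agrees (s m : ℕ) : IsOpen {x : Bin | Agrees s m x} := by
  have : {x : Bin | Agrees s m x} =
      ⋃ z ∈ Xsub s, Set.pi (Finset.Ioo (-(m : ℤ)) m) fun i => {z i} := by
    ext x
    simp only [Set.mem_ofPred_eq, Agrees, Set.mem_iUnion, Set.mem_pi, Finset.mem_coe,
      Finset.mem_Ioo, Set.mem_singleton_iff, exists_prop]
    refine exists_congr fun z => and_congr_right fun _ => forall_congr' fun i => ?_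
    rw [eq_comm]
    refine ⟨fun h hi => h (by omega), fun h hi => h (by omega)⟩
  rw [this]
  exact isOpen_biUnion fun z _ => isOpen_set_pi (Finset.finite_toSet _) fun _ _ => isOpen_discrete _

lemma binDist_nonneg (x y : Bin) : 0 ≤ binDist x y := by
  unfold binDist; split_ifs <;> positivity

lemma binDist_le {x z : Bin} {m : ℕ} (h : ∀ i : ℤ, i.natAbs < m → z i = x i) :
    binDist x z ≤ (1 / 2) ^ m := by
  unfold binDist
  split_ifs with hxz
  · positivity
  · obtain ⟨i, hi⟩ := Function.ne_iff.1 hxz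
    refine pow_le_pow_of_le_one (by norm_num) (by norm_num) (le_csInf ⟨_, i, rfl, hi⟩ ?_)
    rintro _ ⟨i, rfl, hi⟩
    by_contra! hlt
    exact hi (h i hlt).symm

lemma eq_of_binDist {x z : Bin} {m : ℕ} (h : binDist x z < (1 / 2) ^ m) (i : ℤ)
    (hi : i.natAbs ≤ m) : z i = x i := by
  by_contra hne
  unfold binDist at h
  rw [if_neg (by rintro rfl; exact hne rfl)] at h
  have := (pow_lt_pow_iff_right_of_lt_one₀ (by norm_num : (0 : ℝ) < 1 / 2) (by norm_num)).1 h
  have := Nat.sInf_le (s := {m : ℕ | ∃ i : ℤ, i.natAbs = m ∧ x i ≠ z i}) ⟨i, rfl, Ne.symm hne⟩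
  omega

lemma distToSet_nonneg (x : Bin) (S : Set Bin) : 0 ≤ distToSet x S := by
  refine Real.sInf_nonneg ?_
  rintro _ ⟨y, -, rfl⟩
  exact binDist_nonneg x y

lemma bddBelow_binDist (x : Bin) (S : Set Bin) : BddBelow ((fun y => binDist x y) '' S) := by
  refine ⟨0, ?_⟩
  rintro _ ⟨y, -, rfl⟩
  exact binDist_nonneg x y

lemma Agrees.distToSet_le {s m : ℕ} {x : Bin} (h : Agrees s m x) :
    distToSet x (Xsub s) ≤ (1 / 2) ^ m := by
  obtain ⟨z, hz, h⟩ := h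
  exact (csInf_le (bddBelow_binDist _ _) ⟨z, hz, rfl⟩).trans (binDist_le h)

lemma agrees_of_distToSet_lt {s m : ℕ} {x : Bin} (h : distToSet x (Xsub s) < (1 / 2) ^ m) :
    Agrees s (m + 1) x := by
  obtain ⟨z₀, hz₀, -⟩ := agrees_one (s := s) x
  obtain ⟨_, ⟨z, hz, rfl⟩, hlt⟩ := exists_lt_of_csInf_lt (Set.Nonempty.image _ ⟨z₀, hz₀⟩) h
  exact ⟨z, hz, fun i hi => eq_of_binDist hlt i (by omega)⟩

/-- Either `x` has distance `0` to `X_s`, or the distance is `2^{-m}` for the size `m ≥ 1` of the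
largest window on which `x` agrees with `X_s`. -/
lemma distToSet_eq (s : ℕ) (x : Bin) :
    (distToSet x (Xsub s) = 0 ∧ ∀ m, Agrees s m x) ∨
      ∃ m, 1 ≤ m ∧ distToSet x (Xsub s) = (1 / 2) ^ m ∧ Agrees s m x := by
  by_cases h : ∀ m, Agrees s m x
  · refine Or.inl ⟨le_antisymm ?_ (distToSet_nonneg _ _), h⟩
    exact ge_of_tendsto (tendsto_pow_atTop_nhds_zero_of_lt_one (by norm_num) (by norm_num))
      (Eventually.of_forall fun m => (h m).distToSet_le)
  · push Not at h
    classical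
    have h0 := Nat.find_spec h
    have hmin := fun k => Nat.find_min (H := h) (m := k)
    set m := Nat.find h
    have hm : 2 ≤ m := by
      by_contra! hlt
      exact h0 ((agrees_one x).mono (by omega))
    refine Or.inr ⟨m - 1, by omega, le_antisymm ?_ ?_, ?_⟩
    · exact (not_not.1 (hmin (m - 1) (by omega))).distToSet_le
    · by_contra! hlt
      have := agrees_of_distToSet_lt hlt
      rw [Nat.sub_add_cancel (by omega)] at this
      exact h0 this
    · exact not_not.1 (hmin (m - 1) (by omega))

lemma distToSet_eq_zero {s : ℕ} {x : Bin} (hx : x ∈ Xsub s) : distToSet x (Xsub s) = 0 :=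
  le_antisymm (ge_of_tendsto (tendsto_pow_atTop_nhds_zero_of_lt_one (r := (1 / 2 : ℝ))
    (by norm_num) (by norm_num)) (Eventually.of_forall fun _ =>
      Agrees.distToSet_le ⟨x, hx, fun _ _ => rfl⟩)) (distToSet_nonneg _ _)

open Classical in
lemma measurable_distToSet (s : ℕ) : Measurable fun x => distToSet x (Xsub s) := by
  have hbdd : ∀ x, BddBelow (Set.range fun m : ℕ => if Agrees s m x then (1 / 2 : ℝ) ^ m else 1) :=
    fun x => ⟨0, by rintro _ ⟨m, rfl⟩; dsimp only; split_ifs <;> positivity⟩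
  have : (fun x => distToSet x (Xsub s)) =
      fun x => ⨅ m : ℕ, if Agrees s m x then (1 / 2 : ℝ) ^ m else 1 := by
    ext x
    refine le_antisymm (le_ciInf fun m => ?_) ?_
    · split_ifs with h
      · exact h.distToSet_le
      · simpa using (agrees_one x).mono (Nat.zero_le 1) |>.distToSet_le (s := s)
    · rcases distToSet_eq s x with ⟨h, hm⟩ | ⟨m, -, h, hm⟩
      · rw [h]
        refine ge_of_tendsto (tendsto_pow_atTop_nhds_zero_of_lt_one (r := (1 / 2 : ℝ))
          (by norm_num) (by norm_num)) (Eventually.of_forall fun m => ?_)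
        exact (ciInf_le (hbdd x) m).trans (by rw [if_pos (hm m)])
      · rw [h]
        exact (ciInf_le (hbdd x) m).trans (by rw [if_pos hm])
  rw [this]
  exact Measurable.iInf fun m =>
    Measurable.ite (isOpen_agrees s m).measurableSet measurable_const measurable_const

/-! ### The drops `δ_j` and the constants `c_n` -/

lemma deltaOf_half_pow (α : ℝ) (m : ℕ) : deltaOf α ((1 / 2) ^ m) = deltaSeq α m := by
  have h : -Real.logb 2 ((1 / 2) ^ m) = m := by
    rw [one_div, inv_pow, Real.logb_inv, neg_neg, Real.logb_pow]; simp
  rw [deltaOf, if_neg (by positivity), h, deltaSeq]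

lemma logb_two_nonneg {j : ℕ} (hj : 1 ≤ j) : 0 ≤ Real.logb 2 j :=
  Real.logb_nonneg one_lt_two (by exact_mod_cast hj)

lemma logb_two_le (j : ℕ) : Real.logb 2 j ≤ j := by
  rcases Nat.eq_zero_or_pos j with rfl | hj
  · simp
  rw [Real.logb_le_iff_le_rpow one_lt_two (by exact_mod_cast hj), Real.rpow_natCast]
  exact_mod_cast Nat.lt_two_pow_self.le

lemma deltaSeq_nonneg {α : ℝ} (hα : 0 < α) {j : ℕ} (hj : 1 ≤ j) : 0 ≤ deltaSeq α j := by
  have := logb_two_nonneg hj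
  unfold deltaSeq
  positivity

lemma deltaSeq_le {α : ℝ} (hα : 0 < α) {j : ℕ} (hj : 1 ≤ j) : deltaSeq α j ≤ 13 / α := by
  have h1 : (1 : ℝ) ≤ j := by exact_mod_cast hj
  have h2 : 0 < α * j := by positivity
  rw [deltaSeq, div_le_div_iff₀ h2 hα]
  have := logb_two_le j
  nlinarith

lemma logb_le_logb_add {i j : ℕ} (hi : 1 ≤ i) (hij : i ≤ j) :
    Real.logb 2 j ≤ Real.logb 2 i + 2 * ((j : ℝ) / i - 1) := by
  have hi' : (1 : ℝ) ≤ i := by exact_mod_cast hi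
  have hij' : (i : ℝ) ≤ j := by exact_mod_cast hij
  have h1 : (j : ℝ) = i * (j / i) := by field_simp
  have h2 : 0 < (j : ℝ) / i := div_pos (by linarith) (by linarith)
  rw [h1, Real.logb_mul (by positivity) h2.ne', ← h1, add_le_add_iff_left, Real.logb,
    div_le_iff₀ (Real.log_pos one_lt_two)]
  have h3 := Real.log_le_sub_one_of_pos h2
  have h4 := Real.log_two_gt_d9
  have h5 : 1 ≤ (j : ℝ) / i := (one_le_div (by positivity)).2 hij'
  nlinarith

lemma deltaSeq_antitone {α : ℝ} (hα : 0 < α) {i j : ℕ} (hi : 1 ≤ i) (hij : i ≤ j) :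
    deltaSeq α j ≤ deltaSeq α i := by
  have hi' : (1 : ℝ) ≤ i := by exact_mod_cast hi
  have hij' : (i : ℝ) ≤ j := by exact_mod_cast hij
  have h0 := logb_two_nonneg hi
  have h := logb_le_logb_add hi hij
  have h5 : 1 ≤ (j : ℝ) / i := (one_le_div (by positivity)).2 hij'
  have h1 : (j : ℝ) = i * (j / i) := by field_simp
  have hαi : 0 < α * i := by positivity
  have hαj : 0 < α * j := by nlinarith
  rw [deltaSeq, deltaSeq, div_le_div_iff₀ hαj hαi]
  have : 10 + 3 * Real.logb 2 j ≤ (10 + 3 * Real.logb 2 i) * (j / i) := by nlinarith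
  calc _ ≤ (10 + 3 * Real.logb 2 i) * (j / i) * (α * i) := by gcongr
    _ = (10 + 3 * Real.logb 2 i) * (α * (i * (j / i))) := by ring
    _ = _ := by rw [← h1]

/-- The properties of the constants `c_s` that the estimates for `φ` rely on. -/
structure IsLevels (α : ℝ) (c : ℕ → ℝ) : Prop where
  pos : 0 < α
  nonpos : ∀ s, 1 ≤ s → c s ≤ 0
  lower : ∀ s, 1 ≤ s → -((1 / 2) ^ s / α) ≤ c s
  le_succ : ∀ s, 1 ≤ s → c s ≤ c (s + 1)

lemma summable_cseq {α : ℝ} {β : ℕ → ℝ} (hα : 0 < α) (hβ : ∀ n, 1 ≤ n → α < β n) {n : ℕ}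
    (hn : 1 ≤ n) : (∀ k, 0 ≤ 1 / (2 ^ (n + k + 1) * β (n + k))) ∧
    Summable (fun k : ℕ => 1 / (2 ^ (n + k + 1) * β (n + k))) ∧
    ∑' k : ℕ, 1 / (2 ^ (n + k + 1) * β (n + k)) ≤ (1 / 2) ^ n / α := by
  have h0 : ∀ k, 0 ≤ 1 / (2 ^ (n + k + 1) * β (n + k)) := fun k => by
    have := hα.trans (hβ (n + k) (by omega))
    positivity
  have hg : HasSum (fun k : ℕ => (1 / 2 : ℝ) ^ (n + 1) / α * (1 / 2) ^ k) ((1 / 2) ^ n / α) := by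
    have h := hasSum_geometric_two.mul_left ((1 / 2 : ℝ) ^ (n + 1) / α)
    rwa [show (1 / 2 : ℝ) ^ (n + 1) / α * 2 = (1 / 2) ^ n / α by ring] at h
  have hle : ∀ k : ℕ, 1 / (2 ^ (n + k + 1) * β (n + k)) ≤ (1 / 2) ^ (n + 1) / α * (1 / 2) ^ k := by
    intro k
    have h1 := hβ (n + k) (by omega)
    calc 1 / (2 ^ (n + k + 1) * β (n + k)) ≤ 1 / (2 ^ (n + k + 1) * α) := by gcongr
      _ = _ := by rw [one_div_pow, one_div_pow]; field_simp; ring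
  have hs := Summable.of_nonneg_of_le h0 hle hg.summable
  exact ⟨h0, hs, hg.tsum_eq ▸ hs.tsum_le_tsum hle hg.summable⟩

lemma cseq_eq {α : ℝ} {β : ℕ → ℝ} (hα : 0 < α) (hβ : ∀ n, 1 ≤ n → α < β n) {n : ℕ}
    (hn : 1 ≤ n) : cseq β n = cseq β (n + 1) - 1 / (2 ^ (n + 1) * β n) := by
  rw [cseq, (summable_cseq hα hβ hn).2.1.tsum_eq_zero_add, cseq]
  have : ∀ k : ℕ, 1 / (2 ^ (n + 1 + k + 1) * β (n + 1 + k)) =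
      1 / (2 ^ (n + (k + 1) + 1) * β (n + (k + 1))) := fun k => by
    rw [show n + (k + 1) = n + 1 + k by ring]
  rw [tsum_congr this, add_zero]
  ring

lemma isLevels_cseq {α : ℝ} {β : ℕ → ℝ} (hα : 0 < α) (hβ : ∀ n, 1 ≤ n → α < β n) :
    IsLevels α (cseq β) where
  pos := hα
  nonpos s hs := neg_nonpos.2 (tsum_nonneg (summable_cseq hα hβ hs).1)
  lower s hs := neg_le_neg (summable_cseq hα hβ hs).2.2
  le_succ s hs := by
    rw [cseq_eq hα hβ hs, sub_le_self_iff]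
    have := hα.trans (hβ s hs)
    positivity

namespace IsLevels

variable {α : ℝ} {c : ℕ → ℝ}

lemma mono (hc : IsLevels α c) {s s' : ℕ} (hs : 1 ≤ s) (h : s ≤ s') : c s ≤ c s' := by
  induction s', h using Nat.le_induction with
  | base => exact le_rfl
  | succ k hk ih => exact ih.trans (hc.le_succ k (hs.trans hk))

lemma tendsto_zero (hc : IsLevels α c) : Tendsto c atTop (𝓝 0) := by
  have h : Tendsto (fun s : ℕ => -((1 / 2 : ℝ) ^ s / α)) atTop (𝓝 0) := by
    have := ((tendsto_pow_atTop_nhds_zero_of_lt_one (r := (1 / 2 : ℝ)) (by norm_num)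
      (by norm_num)).div_const α).neg
    simpa using this
  refine tendsto_of_tendsto_of_tendsto_of_le_of_le' h tendsto_const_nhds ?_ ?_
  · filter_upwards [eventually_ge_atTop 1] with s hs using hc.lower s hs
  · filter_upwards [eventually_ge_atTop 1] with s hs using hc.nonpos s hs

/-! ### The potential -/

lemma phiN_eq (s : ℕ) (x : Bin) : (phiN α c s x = c s ∧ ∀ m, Agrees s m x) ∨
    ∃ m, 1 ≤ m ∧ phiN α c s x = c s - deltaSeq α m ∧ Agrees s m x := by
  rcases distToSet_eq s x with ⟨h, hm⟩ | ⟨m, h1, h, hm⟩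
  · exact Or.inl ⟨by rw [phiN, h, deltaOf, if_pos rfl, sub_zero], hm⟩
  · exact Or.inr ⟨m, h1, by rw [phiN, h, deltaOf_half_pow], hm⟩

lemma phiN_le (hc : IsLevels α c) (s : ℕ) (x : Bin) : phiN α c s x ≤ c s := by
  rcases phiN_eq (α := α) (c := c) s x with ⟨h, -⟩ | ⟨m, h1, h, -⟩
  · exact h.le
  · rw [h]; linarith [deltaSeq_nonneg hc.pos h1]

lemma phi_le {x : Bin} {B : ℝ} (h : ∀ s, 1 ≤ s → phiN α c s x ≤ B) : phi α c x ≤ B :=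
  ciSup_le fun n => h (n + 1) (by omega)

lemma phiN_le_phi (hc : IsLevels α c) {s : ℕ} (hs : 1 ≤ s) (x : Bin) :
    phiN α c s x ≤ phi α c x := by
  obtain ⟨n, rfl⟩ := Nat.exists_eq_add_of_le' hs
  refine le_ciSup (f := fun n : ℕ => phiN α c (n + 1) x) ⟨0, ?_⟩ n
  rintro _ ⟨n, rfl⟩
  exact (hc.phiN_le (n + 1) x).trans (hc.nonpos _ (by omega))

lemma phi_nonpos (hc : IsLevels α c) (x : Bin) : phi α c x ≤ 0 :=
  phi_le fun s hs => (hc.phiN_le s x).trans (hc.nonpos s hs)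

lemma le_phi (hc : IsLevels α c) (x : Bin) : c 1 - 13 / α ≤ phi α c x := by
  refine le_trans ?_ (hc.phiN_le_phi le_rfl x)
  rcases phiN_eq (α := α) (c := c) 1 x with ⟨h, -⟩ | ⟨m, h1, h, -⟩
  · rw [h, sub_le_self_iff]
    exact div_nonneg (by norm_num) hc.pos.le
  · rw [h]; linarith [deltaSeq_le hc.pos h1]

lemma measurable_phi : Measurable (phi α c) := by
  have hδ : Measurable (deltaOf α) := by
    unfold deltaOf
    refine Measurable.ite (measurableSet_singleton 0) measurable_const ?_
    simp only [Real.logb]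
    fun_prop
  unfold phi phiN
  exact Measurable.iSup fun n => measurable_const.sub (hδ.comp (measurable_distToSet (n + 1)))

lemma integrable_phi (hc : IsLevels α c) (μ : Measure Bin) [IsProbabilityMeasure μ] :
    Integrable (phi α c) μ := by
  refine Integrable.of_bound measurable_phi.aestronglyMeasurable (-(c 1 - 13 / α))
    (ae_of_all _ fun x => ?_)
  rw [Real.norm_eq_abs, abs_of_nonpos (hc.phi_nonpos x)]
  exact neg_le_neg (hc.le_phi x)

lemma half_pow_le_deltaSeq (hc : IsLevels α c) {s m : ℕ} (hm : 1 ≤ m) (h : m ≤ 2 * 2 ^ s) :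
    (1 / 2) ^ s / α ≤ deltaSeq α m := by
  have hα := hc.pos
  have h0 := logb_two_nonneg hm
  have hm' : (0 : ℝ) < m := by exact_mod_cast hm
  have h' : (m : ℝ) ≤ 2 * 2 ^ s := by exact_mod_cast h
  have h1 : 0 < α * m := by positivity
  rw [deltaSeq, one_div_pow, div_div, div_le_div_iff₀ (by positivity) h1]
  have : α * m ≤ α * (2 * 2 ^ s) := by gcongr
  have h2 : 0 < (2 ^ s * α) := by positivity
  nlinarith

lemma phi_eq_of_mem (hc : IsLevels α c) {n : ℕ} (hn : 1 ≤ n) {x : Bin} (hx : x ∈ Xsub n) :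
    phi α c x = c n := by
  refine le_antisymm (phi_le fun s hs => ?_) ?_
  · rcases le_or_gt s n with h | h
    · exact (hc.phiN_le s x).trans (hc.mono hs h)
    · have hlen : ∀ m, Agrees s m x → m ≤ 2 * 2 ^ n := fun m hm => by
        have := (isCodedOn_of_mem hx _ _).length_le hn h hm.isCodedOn
        zify
        omega
      rcases phiN_eq (α := α) (c := c) s x with ⟨-, hm⟩ | ⟨m, h1, h2, hm⟩
      · have := hlen _ (hm (2 * 2 ^ n + 1))
        omega
      · have := hc.half_pow_le_deltaSeq h1 (hlen m hm)
        linarith [hc.nonpos s hs, hc.lower n hn]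
  · refine le_trans ?_ (hc.phiN_le_phi hn x)
    rw [phiN, distToSet_eq_zero hx, deltaOf, if_pos rfl, sub_zero]

lemma integral_phi (hc : IsLevels α c) {n : ℕ} (hn : 1 ≤ n) {μ : Measure Bin}
    [IsProbabilityMeasure μ] (hμ : μ (Xsub n) = 1) : ∫ x, phi α c x ∂μ = c n := by
  have hae : ∀ᵐ x ∂μ, x ∈ Xsub n :=
    mem_ae_iff_prob_eq_one isClosed_closure.measurableSet |>.2 hμ
  rw [integral_congr_ae (g := fun _ => c n) (hae.mono fun x hx => hc.phi_eq_of_mem hn hx)]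
  simp

end IsLevels

/-! ### The variational bound -/

lemma isCodedOn_one {s : ℕ} (x : Bin) : IsCodedOn s x 0 1 := by
  simpa using (agrees_one (s := s) x).isCodedOn

lemma Agrees.le_two_mul {s s' j m p : ℕ} {x : Bin} (hs : 1 ≤ s) (hss : s < s')
    (h : IsCodedOn s x 0 j) (hj : 2 * 2 ^ s < j) (hp : p < j) (hm1 : 1 ≤ m)
    (hm : Agrees s' m (shift^[p] x)) : m ≤ 2 * 2 ^ s := by
  have h1 := hm.isCodedOn.of_shift
  have h2 := (h.mono (l' := max 0 (1 - m + p)) (r' := min j (m + p)) (by omega)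
    (by omega)).length_le hs hss (h1.mono (by omega) (by omega))
  zify at *
  omega

lemma Agrees.le_of_not_isCodedOn {s m : ℕ} {j p : ℕ} {x : Bin}
    (hnot : ∀ s, 1 ≤ s → ¬ IsCodedOn s x 0 (j + 1)) (hp : p < j)  (hs : 1 ≤ s)
    (hm : Agrees s m (shift^[p] x)) : m ≤ j := by
  by_contra! hlt
  exact hnot s hs (hm.isCodedOn.of_shift.mono (by omega) (by omega))

namespace IsLevels

variable {α : ℝ} {c : ℕ → ℝ}

lemma deltaSeq_add_le (hc : IsLevels α c) {s j m : ℕ} (hm : 1 ≤ m) (hm2 : m ≤ 2 * 2 ^ s)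
    (hj : 4 * 2 ^ s ≤ j) : deltaSeq α j + (1 / 2) ^ s / α ≤ deltaSeq α m := by
  have hα := hc.pos
  have h1 : deltaSeq α j ≤ deltaSeq α (4 * 2 ^ s) :=
    deltaSeq_antitone hα (by have := Nat.two_pow_pos s; omega) hj
  have h2 : deltaSeq α (2 * 2 ^ s) ≤ deltaSeq α m := deltaSeq_antitone hα hm hm2
  have hlog : ∀ i : ℕ, Real.logb 2 ((2 ^ i : ℕ) : ℝ) = i := fun i => by
    rw [Nat.cast_pow, Real.logb_pow]
    simp
  have h3 : deltaSeq α (4 * 2 ^ s) = (10 + 3 * ((s : ℝ) + 2)) / 4 * (1 / (2 ^ s * α)) := by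
    rw [deltaSeq, show 4 * 2 ^ s = 2 ^ (s + 2) by ring, hlog]
    push_cast
    field_simp
    ring
  have h4 : deltaSeq α (2 * 2 ^ s) = (10 + 3 * ((s : ℝ) + 1)) / 2 * (1 / (2 ^ s * α)) := by
    rw [deltaSeq, show 2 * 2 ^ s = 2 ^ (s + 1) by ring, hlog]
    push_cast
    field_simp
    ring
  have h5 : (1 / 2 : ℝ) ^ s / α = 1 / (2 ^ s * α) := by rw [one_div_pow, div_div]
  have h6 : 0 < 1 / (2 ^ s * α) := by positivity
  rw [h3] at h1
  rw [h4] at h2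
  rw [h5]
  have : (0 : ℝ) ≤ s := Nat.cast_nonneg s
  nlinarith

lemma phi_iterate_le (hc : IsLevels α c) {s N p : ℕ} {x : Bin} (hs : 1 ≤ s)
    (h : IsCodedOn s x 0 N) (hN : 4 * 2 ^ s ≤ N) (hp : p < N) : phi α c (shift^[p] x) ≤ c s := by
  have hK := Nat.two_pow_pos s
  refine phi_le fun s' hs' => ?_
  rcases le_or_gt s' s with hss | hss
  · exact (hc.phiN_le _ _).trans (hc.mono hs' hss)
  · rcases phiN_eq (α := α) (c := c) s' (shift^[p] x) with ⟨-, hm⟩ | ⟨m, h1, h2, hm⟩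
    · have := (hm (2 * 2 ^ s + 1)).le_two_mul hs hss h (by omega) hp (by omega)
      omega
    · have := hc.half_pow_le_deltaSeq h1 (hm.le_two_mul hs hss h (by omega) hp h1)
      linarith [hc.nonpos s' hs', hc.lower s hs]

lemma phi_iterate_le_neg_deltaSeq (hc : IsLevels α c) {j p : ℕ} {x : Bin}
    (hnot : ∀ s, 1 ≤ s → ¬ IsCodedOn s x 0 (j + 1)) (hp : p < j) :
    phi α c (shift^[p] x) ≤ -deltaSeq α j := by
  refine phi_le fun s hs => ?_
  rcases phiN_eq (α := α) (c := c) s (shift^[p] x) with ⟨-, hm⟩ | ⟨m, h1, h2, hm⟩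
  · have := (hm (j + 1)).le_of_not_isCodedOn hnot hp hs
    omega
  · have := deltaSeq_antitone hc.pos h1 (hm.le_of_not_isCodedOn hnot hp hs)
    linarith [hc.nonpos s hs]

lemma phi_iterate_le_sub_deltaSeq (hc : IsLevels α c) {j p : ℕ} {x : Bin}
    (hnot : ∀ s, 1 ≤ s → ¬ IsCodedOn s x 0 (j + 1)) (hp : p < j) {s : ℕ} (hs : 1 ≤ s)
    (h : IsCodedOn s x 0 j) (hj : 4 * 2 ^ s ≤ j) :
    phi α c (shift^[p] x) ≤ c s - deltaSeq α j := by
  have hK := Nat.two_pow_pos s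
  refine phi_le fun s' hs' => ?_
  rcases phiN_eq (α := α) (c := c) s' (shift^[p] x) with ⟨-, hm⟩ | ⟨m, h1, h2, hm⟩
  · have := (hm (j + 1)).le_of_not_isCodedOn hnot hp hs'
    omega
  · rcases le_or_gt s' s with hss | hss
    · have := deltaSeq_antitone hc.pos h1 (hm.le_of_not_isCodedOn hnot hp hs')
      linarith [hc.mono hs' hss]
    · have := hc.deltaSeq_add_le h1 (hm.le_two_mul hs hss h (by omega) hp h1) hj
      linarith [hc.nonpos s' hs', hc.lower s hs]

end IsLevels

/-- A bound for the weight of a block of length `j` of `X_s`. -/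
def blockWeight (c : ℕ → ℝ) (b P : ℝ) (s j : ℕ) : ℝ :=
  if 4 * 2 ^ s ≤ j then 2 ^ ((j : ℝ) * (b * c s - P)) else 1

open Classical in
/-- The total weight of a word of length `j`, over the coded systems it belongs to. -/
def wordWeight (c : ℕ → ℝ) (b P : ℝ) (j : ℕ) (w : Fin j → Bool) : ℝ :=
  ∑ s ∈ Finset.Ico 1 (Nat.log 2 j + 2),
    if IsCodedOn s (wordExt w) 0 j then blockWeight c b P s j else 0

lemma blockWeight_nonneg (c : ℕ → ℝ) (b P : ℝ) (s j : ℕ) : 0 ≤ blockWeight c b P s j := by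
  unfold blockWeight; split_ifs <;> positivity

lemma wordWeight_nonneg (c : ℕ → ℝ) (b P : ℝ) (j : ℕ) (w : Fin j → Bool) :
    0 ≤ wordWeight c b P j w :=
  Finset.sum_nonneg fun s _ => by
    split_ifs
    · exact blockWeight_nonneg c b P s j
    · exact le_rfl

lemma card_mul_blockWeight_le {c : ℕ → ℝ} {b P : ℝ} {s : ℕ} (h : (1 / 2) ^ s + b * c s ≤ P)
    (j : ℕ) : ((2 ^ s * 2 ^ (j / 2 ^ s + 2) : ℕ) : ℝ) * blockWeight c b P s j ≤ 32 * 2 ^ s := by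
  have hK := Nat.two_pow_pos s
  unfold blockWeight
  split_ifs with hj
  · have h1 : (2 : ℝ) ^ (j / 2 ^ s) * 2 ^ ((j : ℝ) * (b * c s - P)) ≤ 1 := by
      rw [← Real.rpow_natCast, ← Real.rpow_add two_pos]
      refine Real.rpow_le_one_of_one_le_of_nonpos one_le_two ?_
      have h2 : ((j / 2 ^ s : ℕ) : ℝ) ≤ j * (1 / 2) ^ s := by
        refine Nat.cast_div_le.trans_eq ?_
        push_cast
        rw [one_div_pow, mul_one_div]
      nlinarith [(Nat.cast_nonneg j : (0 : ℝ) ≤ j)]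
    have h2 : (0 : ℝ) < 2 ^ s := by positivity
    push_cast
    rw [pow_add]
    nlinarith
  · have h1 : j / 2 ^ s < 4 := by
      rw [Nat.div_lt_iff_lt_mul hK]; omega
    have h2 : 2 ^ (j / 2 ^ s + 2) ≤ 2 ^ 5 := Nat.pow_le_pow_right two_pos (by omega)
    rw [mul_one]
    exact_mod_cast (Nat.mul_le_mul_left _ h2).trans_eq (by ring)

lemma sum_wordWeight_le {c : ℕ → ℝ} {b P : ℝ} (h : ∀ s, 1 ≤ s → (1 / 2) ^ s + b * c s ≤ P)
    {j : ℕ} (hj : 1 ≤ j) : ∑ w, wordWeight c b P j w ≤ 128 * j := by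
  classical
  unfold wordWeight
  rw [Finset.sum_comm]
  calc _ ≤ ∑ s ∈ Finset.Ico 1 (Nat.log 2 j + 2), (32 * 2 ^ s : ℝ) := by
        refine Finset.sum_le_sum fun s hs => ?_
        rw [← Finset.sum_filter, Finset.sum_const, nsmul_eq_mul]
        refine le_trans ?_ (card_mul_blockWeight_le (h s (Finset.mem_Ico.1 hs).1) j)
        refine mul_le_mul_of_nonneg_right ?_ (blockWeight_nonneg c b P s j)
        convert Nat.cast_le (α := ℝ).2 (card_isCodedOn_le s j)
    _ = 32 * ∑ s ∈ Finset.Ico 1 (Nat.log 2 j + 2), (2 : ℝ) ^ s := by rw [Finset.mul_sum]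
    _ ≤ 32 * (2 ^ (Nat.log 2 j + 2)) := by
        gcongr
        rw [geom_sum_Ico (by norm_num) (by omega)]
        norm_num
    _ ≤ 128 * j := by
        have : 2 ^ Nat.log 2 j ≤ j := Nat.pow_log_le_self 2 (by omega)
        have : (2 : ℝ) ^ Nat.log 2 j ≤ j := by exact_mod_cast this
        rw [pow_add]
        linarith

lemma exists_blockWeight_le {c : ℕ → ℝ} (b P : ℝ) {s j : ℕ} {x : Bin} (hs : 1 ≤ s)
    (h : IsCodedOn s x 0 j) : ∃ s', 1 ≤ s' ∧ IsCodedOn s' x 0 j ∧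
      blockWeight c b P s' j ≤ wordWeight c b P j (word x j) := by
  obtain ⟨s', h1, h2, h3⟩ : ∃ s', 1 ≤ s' ∧ s' < Nat.log 2 j + 2 ∧ IsCodedOn s' x 0 j := by
    by_cases hlt : s < Nat.log 2 j + 2
    · exact ⟨s, hs, hlt, h⟩
    · have hj : j < 2 ^ (Nat.log 2 j + 1) := Nat.lt_pow_succ_log_self one_lt_two j
      exact ⟨Nat.log 2 j + 1, by omega, by omega,
        h.of_lt (hj.le.trans (Nat.pow_le_pow_right two_pos (by omega))) hj⟩
  refine ⟨s', h1, h3, ?_⟩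
  classical
  have h4 : IsCodedOn s' (wordExt (word x j)) 0 j := h3.congr fun m hm0 hm1 => wordExt_word x hm0 hm1
  refine le_trans ?_ (Finset.single_le_sum (f := fun s => if IsCodedOn s (wordExt (word x j)) 0 j
    then blockWeight c b P s j else 0) (fun s _ => ?_) (Finset.mem_Ico.2 ⟨h1, h2⟩))
  · simp only [h4, if_true, le_refl]
  · split_ifs
    · exact blockWeight_nonneg c b P s j
    · exact le_rfl

lemma rpow_sum_le {F : Bin → ℝ} {x : Bin} {j : ℕ} {B : ℝ} (h : ∀ p < j, F (shift^[p] x) ≤ B) :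
    (2 : ℝ) ^ (∑ p ∈ Finset.range j, F (shift^[p] x)) ≤ 2 ^ (j * B) := by
  refine Real.rpow_le_rpow_of_exponent_le one_le_two ?_
  calc _ ≤ ∑ p ∈ Finset.range j, B := Finset.sum_le_sum fun p hp => h p (Finset.mem_range.1 hp)
    _ = j * B := by simp

lemma exists_isCodedOn_maximal (x : Bin) {N : ℕ} (hN : 1 ≤ N)
    (h : ¬ ∃ s, 1 ≤ s ∧ IsCodedOn s x 0 N) : ∃ j, 1 ≤ j ∧ j < N ∧
      (∃ s, 1 ≤ s ∧ IsCodedOn s x 0 j) ∧ ∀ s, 1 ≤ s → ¬ IsCodedOn s x 0 (j + 1) := by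
  classical
  have hN1 : ∀ s, 1 ≤ s → ¬ IsCodedOn s x 0 ((N - 1 : ℕ) + 1) := fun s hs hx => h ⟨s, hs, by
    rwa [Nat.cast_sub hN, Nat.cast_one, sub_add_cancel] at hx⟩
  have hex : ∃ j : ℕ, ∀ s, 1 ≤ s → ¬ IsCodedOn s x 0 (j + 1) := ⟨N - 1, hN1⟩
  have h0 := Nat.find_spec hex
  have hmin := fun k => Nat.find_min (H := hex) (m := k)
  have hle : Nat.find hex ≤ N - 1 := Nat.find_min' hex hN1
  set j := Nat.find hex
  have hj : 1 ≤ j := by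
    by_contra! hlt
    refine h0 1 le_rfl ?_
    rw [show j = 0 by omega, Nat.cast_zero, zero_add]
    exact isCodedOn_one x
  refine ⟨j, hj, by omega, ?_, h0⟩
  have := hmin (j - 1) (by omega)
  push Not at this
  rwa [Nat.cast_sub hj, Nat.cast_one, sub_add_cancel] at this

namespace IsLevels

variable {α : ℝ} {c : ℕ → ℝ}

lemma rpow_sum_phi_le_blockWeight (hc : IsLevels α c) {b P : ℝ} (hb : 0 ≤ b) (hP : 0 ≤ P)
    {s N : ℕ} {x : Bin} (hs : 1 ≤ s) (h : IsCodedOn s x 0 N) :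
    (2 : ℝ) ^ (∑ p ∈ Finset.range N, (b * phi α c (shift^[p] x) - P)) ≤ blockWeight c b P s N := by
  unfold blockWeight
  split_ifs with hN
  · refine rpow_sum_le (F := fun x => b * phi α c x - P) fun p hp => ?_
    have := mul_le_mul_of_nonneg_left (hc.phi_iterate_le hs h hN hp) hb
    linarith
  · have := rpow_sum_le (F := fun x => b * phi α c x - P) (B := 0) (j := N) (x := x) fun p hp => by
      have := mul_nonpos_of_nonneg_of_nonpos hb (hc.phi_nonpos (shift^[p] x))
      linarith
    simpa using this

lemma rpow_sum_phi_le_of_not_isCodedOn (hc : IsLevels α c) {b P : ℝ} (hb : α ≤ b) (hP : 0 ≤ P)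
    {s j : ℕ} {x : Bin} (hs : 1 ≤ s) (hj : 1 ≤ j) (h : IsCodedOn s x 0 j)
    (hnot : ∀ s, 1 ≤ s → ¬ IsCodedOn s x 0 (j + 1)) :
    (2 : ℝ) ^ (∑ p ∈ Finset.range j, (b * phi α c (shift^[p] x) - P)) ≤
      blockWeight c b P s j / (1024 * (j : ℝ) ^ 3) := by
  have hα := hc.pos
  have hb0 : 0 ≤ b := hα.le.trans hb
  have hj' : (0 : ℝ) < j := by exact_mod_cast hj
  have hδ : 10 + 3 * Real.logb 2 j ≤ j * (b * deltaSeq α j) := by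
    have h1 : 10 + 3 * Real.logb 2 j = j * (α * deltaSeq α j) := by
      rw [deltaSeq]; field_simp
    rw [h1]
    have := deltaSeq_nonneg hα hj
    gcongr
  have hpow : (2 : ℝ) ^ (-(j * (b * deltaSeq α j))) ≤ 1 / (1024 * (j : ℝ) ^ 3) := by
    calc (2 : ℝ) ^ (-(j * (b * deltaSeq α j))) ≤ 2 ^ (-(10 + 3 * Real.logb 2 j)) :=
          Real.rpow_le_rpow_of_exponent_le one_le_two (neg_le_neg hδ)
      _ = _ := by
          rw [Real.rpow_neg two_pos.le, Real.rpow_add two_pos, mul_comm 3, Real.rpow_mul two_pos.le,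
            Real.rpow_logb two_pos (by norm_num) hj', one_div]
          norm_num
  have hsplit : ∀ B : ℝ, (2 : ℝ) ^ ((j : ℝ) * (B - b * deltaSeq α j)) ≤
      2 ^ ((j : ℝ) * B) / (1024 * (j : ℝ) ^ 3) := fun B => by
    rw [mul_sub, sub_eq_add_neg, Real.rpow_add two_pos, div_eq_mul_one_div]
    gcongr
  unfold blockWeight
  split_ifs with hjs
  · refine le_trans (rpow_sum_le (F := fun x => b * phi α c x - P) fun p hp => ?_) (hsplit _)
    have := mul_le_mul_of_nonneg_left (hc.phi_iterate_le_sub_deltaSeq hnot hp hs h hjs) hb0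
    linarith
  · refine le_trans (rpow_sum_le (F := fun x => b * phi α c x - P) fun p hp => ?_)
      ((hsplit 0).trans_eq (by simp))
    have := mul_le_mul_of_nonneg_left (hc.phi_iterate_le_neg_deltaSeq hnot hp) hb0
    linarith

theorem entObsT_le (hc : IsLevels α c) {b P : ℝ} (hb : α ≤ b) (hP : 0 ≤ P)
    (hPs : ∀ s, 1 ≤ s → (1 / 2) ^ s + b * c s ≤ P) {μ : Measure Bin} (hμ : InvProb shift μ)
    {k : ℕ} {f : Bin → Fin k} (hf : Measurable f) :
    entObsT shift μ f ≤ P - b * ∫ x, phi α c x ∂μ := by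
  have hμ1 := hμ.1
  have hb0 : 0 ≤ b := hc.pos.le.trans hb
  have hint := hc.integrable_phi μ
  set F : Bin → ℝ := fun x => b * phi α c x - P
  have hF : Integrable F μ := (hint.const_mul b).sub (integrable_const P)
  have hren : ∀ N : ℕ, 1 ≤ N → ∃ q : (Fin N → Bool) → ℝ, (∀ w, 0 ≤ q w) ∧
      ∑ w, q w ≤ 128 * (N : ℝ) ^ 4 ∧
        ∀ x, (2 : ℝ) ^ (∑ i ∈ Finset.range N, F (shift^[i] x)) ≤ q (word x N) := by
    refine exists_renewal_weight
      (u := fun j w => wordWeight c b P j w / (1024 * (j : ℝ) ^ 3)) (u' := wordWeight c b P)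
      (fun j w => div_nonneg (wordWeight_nonneg c b P j w) (by positivity))
      (wordWeight_nonneg c b P) (by norm_num) (fun N => ?_) (fun N hN => ?_) (fun x N hN => ?_)
    · calc _ ≤ ∑ j ∈ Finset.Ioo 0 N, (1 / 8 : ℝ) * ((j : ℝ) ^ 2)⁻¹ := by
            refine Finset.sum_le_sum fun j hj => ?_
            have hj1 : 1 ≤ j := (Finset.mem_Ioo.1 hj).1
            have hj' : (0 : ℝ) < j := by exact_mod_cast hj1
            rw [← Finset.sum_div, div_le_iff₀ (by positivity)]
            refine (sum_wordWeight_le hPs hj1).trans_eq ?_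
            field_simp
            norm_num
        _ = 1 / 8 * ∑ j ∈ Finset.Ioo 0 N, ((j : ℝ) ^ 2)⁻¹ := by rw [Finset.mul_sum]
        _ ≤ 1 / 8 * (2 / ((0 : ℕ) + 1)) := by gcongr; exact sum_Ioo_inv_sq_le 0 N
        _ ≤ 1 := by norm_num
    · have hN' : (1 : ℝ) ≤ N := by exact_mod_cast hN
      refine (sum_wordWeight_le hPs hN).trans ?_
      gcongr
      exact le_self_pow₀ hN' (by norm_num)
    · by_cases h : ∃ s, 1 ≤ s ∧ IsCodedOn s x 0 N
      · obtain ⟨s, hs, h⟩ := h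
        obtain ⟨s', hs', h', hle⟩ := exists_blockWeight_le (c := c) b P hs h
        exact Or.inl ((hc.rpow_sum_phi_le_blockWeight hb0 hP hs' h').trans hle)
      · obtain ⟨j, hj, hjN, ⟨s, hs, h⟩, hnot⟩ := exists_isCodedOn_maximal x hN h
        obtain ⟨s', hs', h', hle⟩ := exists_blockWeight_le (c := c) b P hs h
        refine Or.inr ⟨j, hj, hjN, ?_⟩
        refine (hc.rpow_sum_phi_le_of_not_isCodedOn hb hP hs' hj h' hnot).trans ?_
        gcongr
  choose! q hq0 hqs hqF using hren
  have := entObsT_le_neg_integral hμ hF (by norm_num : (0 : ℝ) < 128) (q := q) hqF hqs hf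
  rw [integral_sub (hint.const_mul b) (integrable_const P), integral_const_mul] at this
  simpa using this

theorem kolSinai_le (hc : IsLevels α c) {b P : ℝ} (hb : α ≤ b) (hP : 0 ≤ P)
    (hPs : ∀ s, 1 ≤ s → (1 / 2) ^ s + b * c s ≤ P) {μ : Measure Bin} (hμ : InvProb shift μ) :
    kolSinai shift μ + b * ∫ x, phi α c x ∂μ ≤ P ∧
      ∀ (k : ℕ) (f : Bin → Fin k), Measurable f → entObsT shift μ f ≤ kolSinai shift μ := by
  have h0 : 0 ≤ P - b * ∫ x, phi α c x ∂μ := by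
    have := integral_nonpos (μ := μ) (f := phi α c) hc.phi_nonpos
    nlinarith [hc.pos]
  have h1 : ∀ (k : ℕ) (f : {f : Bin → Fin k // Measurable f}),
      entObsT shift μ f.1 ≤ P - b * ∫ x, phi α c x ∂μ := fun k f => hc.entObsT_le hb hP hPs hμ f.2
  have h2 : ∀ k : ℕ, (⨆ f : {f : Bin → Fin k // Measurable f}, entObsT shift μ f.1) ≤
      P - b * ∫ x, phi α c x ∂μ := fun k => Real.iSup_le (h1 k) h0
  refine ⟨by have := Real.iSup_le h2 h0; unfold kolSinai; linarith, fun k f hf => ?_⟩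
  refine le_trans ?_ (le_ciSup (f := fun k : ℕ => ⨆ f : {f : Bin → Fin k // Measurable f},
    entObsT shift μ f.1) ⟨_, Set.forall_mem_range.2 h2⟩ k)
  exact le_ciSup (f := fun f : {f : Bin → Fin k // Measurable f} => entObsT shift μ f.1)
    ⟨_, Set.forall_mem_range.2 (h1 k)⟩ ⟨f, hf⟩

end IsLevels

/-! ### An invariant measure of large entropy on `X_s` -/

lemma le_entOfObs {X F : Type*} [MeasurableSpace X] [Fintype F] [MeasurableSpace F]
    [MeasurableSingletonClass F] {μ : Measure X} [IsProbabilityMeasure μ] {f : X → F}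
    (hf : Measurable f) {L : ℕ} (h : ∀ a, μ (f ⁻¹' {a}) ≤ (1 / 2) ^ L) : L ≤ entOfObs μ f := by
  have : IsProbabilityMeasure (μ.map f) := Measure.isProbabilityMeasure_map hf.aemeasurable
  have hreal : ∀ a, (μ (f ⁻¹' {a})).toReal = (μ.map f).real {a} := fun a => by
    rw [Measure.real, Measure.map_apply hf (measurableSet_singleton a)]
  have h1 : ∑ a, (μ (f ⁻¹' {a})).toReal = 1 := by
    simp_rw [hreal]
    rw [sum_measureReal_singleton, Finset.coe_univ, probReal_univ]
  calc (L : ℝ) = ∑ a, (μ (f ⁻¹' {a})).toReal * L := by rw [← Finset.sum_mul, h1, one_mul]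
    _ ≤ entOfObs μ f := by
      refine Finset.sum_le_sum fun a _ => ?_
      have hle : (μ (f ⁻¹' {a})).toReal ≤ (1 / 2) ^ L := by
        have := ENNReal.toReal_mono (by simp) (h a)
        simpa using this
      rcases ENNReal.toReal_nonneg.eq_or_lt (a := (0 : ℝ)) (b := (μ (f ⁻¹' {a})).toReal) with h0 | h0
      · simp [← h0]
      · rw [← mul_neg]
        refine mul_le_mul_of_nonneg_left ?_ h0.le
        have := Real.logb_le_logb_of_le one_lt_two h0 hle
        rw [one_div, inv_pow, Real.logb_inv, Real.logb_pow, Real.logb_self_eq_one one_lt_two] at this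
        linarith

/-- The fair coin. -/
def fairCoin : Measure Bool := (PMF.uniformOfFintype Bool).toMeasure

/-- The Bernoulli measure of two-sided sequences of independent fair coins. -/
def fairCoins : Measure Bin := Measure.infinitePi fun _ => fairCoin

instance : IsProbabilityMeasure fairCoin := by unfold fairCoin; infer_instance

instance : IsProbabilityMeasure fairCoins := by unfold fairCoins; infer_instance

lemma fairCoin_singleton (b : Bool) : fairCoin {b} = 1 / 2 := by
  rw [fairCoin, PMF.toMeasure_uniformOfFintype_apply _ (measurableSet_singleton b)]
  simp

lemma map_shift_fairCoins : fairCoins.map shift = fairCoins := by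
  refine Measure.eq_infinitePi _ fun s t ht => ?_
  have hpre : shift ⁻¹' Set.pi s t =
      Set.pi (s.map (Equiv.addRight (1 : ℤ)).toEmbedding : Finset ℤ) fun i => t (i - 1) := by
    ext a
    simp only [Set.mem_preimage, Set.mem_pi, Finset.mem_coe, Finset.mem_map_equiv]
    refine ⟨fun h i hi => ?_, fun h i hi => ?_⟩
    · have := h (i - 1) (by simpa [sub_eq_add_neg] using hi)
      rwa [shift, sub_add_cancel] at this
    · have := h (i + 1) (by simpa using hi)
      rwa [add_sub_cancel_right] at this
  rw [Measure.map_apply measurable_shift (MeasurableSet.pi s.countable_toSet fun i _ => ht i),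
    hpre, fairCoins, Measure.infinitePi_pi _ fun i _ => ht _]
  simp

lemma fairCoins_cylinder (L : ℕ) (v : ℕ → Bool) :
    fairCoins {a | ∀ l < L, a (l : ℤ) = v l} = (1 / 2) ^ L := by
  have : {a : Bin | ∀ l < L, a (l : ℤ) = v l} =
      Set.pi ((Finset.range L).map Nat.castEmbedding : Finset ℤ) fun i => {v i.toNat} := by
    ext a
    simp
  rw [this, fairCoins, Measure.infinitePi_pi _ fun i _ => measurableSet_singleton _]
  simp [fairCoin_singleton]

lemma measurable_code (s : ℕ) (t : ℤ) : Measurable fun a => code s a t := by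
  refine measurable_pi_lambda _ fun m => ?_
  exact (measurable_of_finite fun b : Bool => xor b (decide ((m + t) % 2 ^ s = 2 ^ s - 1))).comp
    (measurable_pi_apply _)

/-- The average of the images of the Bernoulli measure under the `2^s` codings. -/
def codeMeasure (s : ℕ) : Measure Bin :=
  ((2 ^ s : ℕ) : ENNReal)⁻¹ •
    ∑ t ∈ Finset.range (2 ^ s), fairCoins.map fun a => code s a ((t : ℕ) : ℤ)

lemma codeMeasure_apply (s : ℕ) {A : Set Bin} (hA : MeasurableSet A) : codeMeasure s A =
    ((2 ^ s : ℕ) : ENNReal)⁻¹ *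
      ∑ t ∈ Finset.range (2 ^ s), fairCoins ((fun a => code s a ((t : ℕ) : ℤ)) ⁻¹' A) := by
  rw [codeMeasure, Measure.smul_apply, Measure.finsetSum_apply, smul_eq_mul]
  congr 1
  exact Finset.sum_congr rfl fun t _ => Measure.map_apply (measurable_code s t) hA

lemma codeMeasure_le (s : ℕ) {A : Set Bin} (hA : MeasurableSet A) {e : ENNReal}
    (h : ∀ t < 2 ^ s, fairCoins ((fun a => code s a ((t : ℕ) : ℤ)) ⁻¹' A) ≤ e) :
    codeMeasure s A ≤ e := by
  rw [codeMeasure_apply s hA]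
  calc _ ≤ ((2 ^ s : ℕ) : ENNReal)⁻¹ * ∑ t ∈ Finset.range (2 ^ s), e := by
        gcongr with t ht
        exact h t (Finset.mem_range.1 ht)
    _ = e := by
        rw [Finset.sum_const, Finset.card_range, nsmul_eq_mul, ← mul_assoc,
          ENNReal.inv_mul_cancel (by simp) (by simp), one_mul]

lemma codeMeasure_eq_one (s : ℕ) {A : Set Bin} (hA : MeasurableSet A)
    (h : ∀ a t, code s a t ∈ A) : codeMeasure s A = 1 := by
  have : ∀ t : ℤ, (fun a => code s a t) ⁻¹' A = Set.univ := fun t =>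
    Set.eq_univ_of_forall fun a => h a t
  rw [codeMeasure_apply s hA]
  simp only [this, measure_univ]
  rw [Finset.sum_const, Finset.card_range, nsmul_eq_mul, mul_one,
    ENNReal.inv_mul_cancel (by simp) (by simp)]

lemma codeMeasure_Xsub (s : ℕ) : codeMeasure s (Xsub s) = 1 :=
  codeMeasure_eq_one s isClosed_closure.measurableSet (code_mem_Xsub s)

lemma invProb_codeMeasure (s : ℕ) : InvProb shift (codeMeasure s) := by
  refine ⟨⟨codeMeasure_eq_one s .univ fun _ _ => Set.mem_univ _⟩, measurable_shift, ?_⟩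
  ext A hA
  rw [Measure.map_apply measurable_shift hA, codeMeasure_apply s hA,
    codeMeasure_apply s (measurable_shift hA)]
  congr 1
  set g : ℕ → ENNReal := fun t => fairCoins ((fun a => code s a ((t : ℕ) : ℤ)) ⁻¹' A)
  have hstep : ∀ t : ℕ, fairCoins ((fun a => code s a ((t : ℕ) : ℤ)) ⁻¹' (shift ⁻¹' A)) =
      g (t + 1) := fun t => by
    have : ∀ a, shift (code s a t) = code s a ((t + 1 : ℕ) : ℤ) := fun a => by
      ext m
      rw [shift, code_add]
      push_cast
      rfl
    simp only [g, Set.preimage, Set.mem_ofPred_eq, this]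
  have hlast : g (2 ^ s) = g 0 := by
    have : ∀ a, code s a ((2 ^ s : ℕ) : ℤ) = code s (shift a) ((0 : ℕ) : ℤ) := fun a => by
      have := code_add_mul s a 0 1
      rw [mul_one, zero_add] at this
      push_cast
      exact this
    have h2 : (fun a => code s a ((2 ^ s : ℕ) : ℤ)) ⁻¹' A =
        shift ⁻¹' ((fun a => code s a ((0 : ℕ) : ℤ)) ⁻¹' A) := by
      ext a
      simp only [Set.mem_preimage, this]
    simp only [g]
    rw [h2, ← Measure.map_apply measurable_shift (measurable_code s _ hA), map_shift_fairCoins]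
  rw [Finset.sum_congr rfl fun t _ => hstep t]
  obtain ⟨k, hk⟩ := Nat.exists_eq_add_of_le' (Nat.one_le_two_pow (n := s))
  rw [hk] at hlast ⊢
  rw [Finset.sum_range_succ, hlast, ← Finset.sum_range_succ' g k]

lemma codeMeasure_cylinder_le (s N L : ℕ) (hL : ∀ l < L, l * 2 ^ s < N) (w : Fin N → Bool) :
    codeMeasure s {x | word x N = w} ≤ (1 / 2) ^ L := by
  have hw : Measurable fun x : Bin => word x N :=
    measurable_pi_lambda _ fun i => measurable_pi_apply _
  refine codeMeasure_le s (hw (measurableSet_singleton w)) fun t ht => ?_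
  have ht' : (t : ℤ) < 2 ^ s := by exact_mod_cast ht
  rw [← fairCoins_cylinder L fun l =>
    xor (wordExt w ((l * 2 ^ s : ℕ) : ℤ)) (decide ((t : ℤ) = 2 ^ s - 1))]
  refine measure_mono fun a ha l hl => ?_
  have ha : word (code s a t) N = w := ha
  rw [← ha, wordExt_word _ (Int.natCast_nonneg _) (by exact_mod_cast hL l hl),
    code_apply a (e := l) (ρ := t) (by push_cast; ring) (by omega) ht', Bool.xor_assoc,
    Bool.xor_self, Bool.xor_false]

lemma exists_le_entObsT_codeMeasure (s : ℕ) : ∃ f : Bin → Fin 2, Measurable f ∧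
    (1 / 2) ^ s ≤ entObsT shift (codeMeasure s) f := by
  have hν := invProb_codeMeasure s
  have hν1 := hν.1
  have hK := Nat.two_pow_pos s
  have hf : Measurable fun x : Bin => finTwoEquiv.symm (x 0) :=
    (measurable_of_finite finTwoEquiv.symm).comp (measurable_pi_apply 0)
  refine ⟨_, hf, le_ciInf fun n => ?_⟩
  have hL1 : (n + 1 + 2 ^ s - 1) / 2 ^ s * 2 ^ s ≤ n + 1 + 2 ^ s - 1 := Nat.div_mul_le_self _ _
  have hL2 := Nat.lt_div_mul_add (a := n + 1 + 2 ^ s - 1) hK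
  set L := (n + 1 + 2 ^ s - 1) / 2 ^ s
  have hle : (L : ℝ) ≤ entOfObs (codeMeasure s)
      (fun x => fun i : Fin (n + 1) => finTwoEquiv.symm (shift^[(i : ℕ)] x 0)) := by
    refine le_entOfObs ?_ fun a => ?_
    · exact measurable_pi_lambda _ fun i => hf.comp (measurable_shift.iterate i)
    · convert codeMeasure_cylinder_le s (n + 1) L (fun l hl => ?_) (fun i => finTwoEquiv (a i)) using 2
      · ext x
        simp only [Set.mem_preimage, Set.mem_singleton_iff, funext_iff, Set.mem_ofPred_eq, word,
          iterate_shift, zero_add, Equiv.symm_apply_eq]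
      · have : (l + 1) * 2 ^ s ≤ L * 2 ^ s := Nat.mul_le_mul_right _ hl
        rw [add_mul] at this
        omega
  rw [le_div_iff₀ (by positivity)]
  refine le_trans ?_ hle
  have h1 : n + 1 ≤ L * 2 ^ s := by omega
  have h2 : ((n : ℝ) + 1) ≤ L * 2 ^ s := by exact_mod_cast h1
  rw [one_div_pow, one_div_mul_eq_div, div_le_iff₀ (by positivity)]
  exact h2

/-! ### The maximal level -/

lemma IsLevels.half_pow_le_kolSinai {α : ℝ} {c : ℕ → ℝ} (hc : IsLevels α c) (s : ℕ) :
    (1 / 2) ^ s ≤ kolSinai shift (codeMeasure s) := by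
  obtain ⟨f, hf, hle⟩ := exists_le_entObsT_codeMeasure s
  refine hle.trans ((hc.kolSinai_le le_rfl zero_le_one (fun s hs => ?_)
    (invProb_codeMeasure s)).2 2 f hf)
  have h1 : (1 / 2 : ℝ) ^ s ≤ 1 := pow_le_one₀ (by norm_num) (by norm_num)
  nlinarith [hc.pos, hc.nonpos s hs]

lemma tendsto_level {α : ℝ} {c : ℕ → ℝ} (hc : IsLevels α c) (b : ℝ) :
    Tendsto (fun s : ℕ => (1 / 2 : ℝ) ^ s + b * c s) atTop (𝓝 0) := by
  have := (tendsto_pow_atTop_nhds_zero_of_lt_one (r := (1 / 2 : ℝ)) (by norm_num)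
    (by norm_num)).add (hc.tendsto_zero.const_mul b)
  simpa using this

lemma level_sub {α : ℝ} {β : ℕ → ℝ} (hα : 0 < α) (hβ : ∀ n, 1 ≤ n → α < β n) (b : ℝ) {s : ℕ}
    (hs : 1 ≤ s) : ((1 / 2 : ℝ) ^ (s + 1) + b * cseq β (s + 1)) - ((1 / 2) ^ s + b * cseq β s) =
      (b - β s) / (2 ^ (s + 1) * β s) := by
  have h0 := hα.trans (hβ s hs)
  rw [cseq_eq hα hβ hs, one_div_pow, one_div_pow]
  field_simp
  ring

lemma level_le {α : ℝ} {β : ℕ → ℝ} (hα : 0 < α) (hβ : ∀ n, 1 ≤ n → α < β n) {b : ℝ} {n : ℕ}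
    (hn : 1 ≤ n) (h1 : ∀ s, 1 ≤ s → s < n → β s ≤ b) (h2 : ∀ s, n ≤ s → b ≤ β s) :
    (∀ s, 1 ≤ s → (1 / 2 : ℝ) ^ s + b * cseq β s ≤ (1 / 2) ^ n + b * cseq β n) ∧
      0 ≤ (1 / 2 : ℝ) ^ n + b * cseq β n := by
  have hpos : ∀ s, 1 ≤ s → 0 < 2 ^ (s + 1) * β s := fun s hs => by
    have := hα.trans (hβ s hs)
    positivity
  have hge : ∀ s, n ≤ s → (1 / 2 : ℝ) ^ s + b * cseq β s ≤ (1 / 2) ^ n + b * cseq β n := by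
    intro s hs
    induction s, hs using Nat.le_induction with
    | base => exact le_rfl
    | succ s hs ih =>
      have := div_nonpos_of_nonpos_of_nonneg (sub_nonpos.2 (h2 s hs)) (hpos s (hn.trans hs)).le
      linarith [level_sub hα hβ b (hn.trans hs)]
  refine ⟨fun s hs => ?_, le_of_tendsto (tendsto_level (isLevels_cseq hα hβ) b)
    ((eventually_ge_atTop n).mono hge)⟩
  rcases le_or_gt n s with h | h
  · exact hge s h
  · clear hge h2
    induction n, h.le using Nat.le_induction with
    | base => exact le_rfl
    | succ k hk ih =>
      have hle : (1 / 2 : ℝ) ^ s + b * cseq β s ≤ (1 / 2) ^ k + b * cseq β k := by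
        rcases hk.eq_or_lt with rfl | hlt
        · exact le_rfl
        · exact ih (hs.trans hk) (fun s hs hsk => h1 s hs (by omega)) hlt
      have := div_nonneg (sub_nonneg.2 (h1 k (hs.trans hk) (by omega))) (hpos k (hs.trans hk)).le
      linarith [level_sub hα hβ b (hs.trans hk)]

lemma kolSinai_le_half_pow {α : ℝ} {β : ℕ → ℝ} (hα : 0 < α) (hβ : ∀ n, 1 ≤ n → α < β n)
    (hmono : ∀ m n : ℕ, 1 ≤ m → m < n → β m < β n) {n : ℕ} (hn : 1 ≤ n) {μ : Measure Bin}
    (hμ : InvProb shift μ) (hμn : μ (Xsub n) = 1) : kolSinai shift μ ≤ (1 / 2) ^ n := by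
  have hμ1 := hμ.1
  have hc := isLevels_cseq hα hβ
  obtain ⟨hP, hP0⟩ := level_le hα hβ (b := β n) hn (fun s hs h => (hmono s n hs h).le)
    (fun s hs => hs.eq_or_lt.elim (fun h => h ▸ le_rfl) fun h => (hmono n s hn h).le)
  have := (hc.kolSinai_le (hβ n hn).le hP0 hP hμ).1
  rw [hc.integral_phi hn hμn] at this
  linarith

/-- the variational bound and the formula for the pressure. -/
theorem pressure_formula (α : ℝ) (β : ℕ → ℝ) (hα : 0 < α) (hαβ : α < β 1)
    (hmono : ∀ m n : ℕ, 1 ≤ m → m < n → β m < β n)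
    (μseq : ℕ → Measure Bin)
    (hmme : ∀ n : ℕ, 1 ≤ n → IsMaxEntropyOn (Xsub n) (μseq n) ∧
      ∀ ν : Measure Bin, IsMaxEntropyOn (Xsub n) ν → ν = μseq n) :
    (∀ μ : Measure Bin, IsProbabilityMeasure μ → Ergodic shift μ →
      ∀ n : ℕ, 1 ≤ n → ∀ b : ℝ,
        ((n = 1 ∧ b ∈ Set.Icc α (β 1)) ∨ (2 ≤ n ∧ b ∈ Set.Icc (β (n - 1)) (β n))) →
        kolSinai shift μ + b * ∫ x, phi α (cseq β) x ∂μ ≤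
            (1 / 2 : ℝ) ^ n + b * cseq β n ∧
          (1 / 2 : ℝ) ^ n + b * cseq β n =
            kolSinai shift (μseq n) + b * ∫ x, phi α (cseq β) x ∂(μseq n)) ∧
    (∀ b : ℝ, α ≤ b →
      pressure shift (fun x => b * phi α (cseq β) x) =
          (⨆ n : ℕ, pressureOn (Xsub (n + 1)) (fun x => b * phi α (cseq β) x)) ∧
        pressure shift (fun x => b * phi α (cseq β) x) =
          ⨆ n : ℕ, ((1 / 2 : ℝ) ^ (n + 1) + b * cseq β (n + 1))) := by
  have hβ : ∀ n, 1 ≤ n → α < β n := fun n hn =>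
    hn.eq_or_lt.elim (fun h => h ▸ hαβ) fun h => hαβ.trans (hmono 1 n le_rfl h)
  have hc := isLevels_cseq hα hβ
  have hent : ∀ n, 1 ≤ n → kolSinai shift (μseq n) = (1 / 2) ^ n := fun n hn => by
    obtain ⟨hinv, hone, hmax⟩ := (hmme n hn).1
    exact le_antisymm (kolSinai_le_half_pow hα hβ hmono hn hinv hone)
      ((hc.half_pow_le_kolSinai n).trans
        (hmax _ (invProb_codeMeasure n) (codeMeasure_Xsub n)))
  have hint : ∀ n, 1 ≤ n → ∫ x, phi α (cseq β) x ∂(μseq n) = cseq β n := fun n hn => by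
    obtain ⟨hinv, hone, -⟩ := (hmme n hn).1
    have := hinv.1
    exact hc.integral_phi hn hone
  refine ⟨fun μ hμ herg n hn b hb => ?_, fun b hb => ?_⟩
  · have hbα : α ≤ b := by
      rcases hb with ⟨rfl, hb⟩ | ⟨hn2, hb⟩
      · exact hb.1
      · exact (hβ (n - 1) (by omega)).le.trans hb.1
    have hbn : b ≤ β n := by
      rcases hb with ⟨rfl, hb⟩ | ⟨hn2, hb⟩ <;> exact hb.2
    obtain ⟨hP, hP0⟩ := level_le hα hβ (b := b) hn (fun s hs h => by
        rcases hb with ⟨rfl, hb⟩ | ⟨hn2, hb⟩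
        · omega
        · refine le_trans ?_ hb.1
          rcases (Nat.le_sub_one_of_lt h).eq_or_lt with h | h
          · rw [h]
          · exact (hmono s _ hs h).le)
      (fun s hs => hbn.trans
        (hs.eq_or_lt.elim (fun h => h ▸ le_rfl) fun h => (hmono n s hn h).le))
    exact ⟨(hc.kolSinai_le hbα hP0 hP ⟨hμ, herg.toMeasurePreserving⟩).1,
      by rw [hent n hn, hint n hn]⟩
  · have hb0 : 0 < b := hα.trans_le hb
    have hbdd : BddAbove
        (Set.range fun n : ℕ => (1 / 2 : ℝ) ^ (n + 1) + b * cseq β (n + 1)) := by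
      refine ⟨1, Set.forall_mem_range.2 fun n => ?_⟩
      have h1 : (1 / 2 : ℝ) ^ (n + 1) ≤ 1 := pow_le_one₀ (by norm_num) (by norm_num)
      nlinarith [hc.nonpos (n + 1) (by omega)]
    have hP : ∀ s, 1 ≤ s → (1 / 2 : ℝ) ^ s + b * cseq β s ≤
        ⨆ n : ℕ, ((1 / 2 : ℝ) ^ (n + 1) + b * cseq β (n + 1)) := fun s hs => by
      obtain ⟨n, rfl⟩ := Nat.exists_eq_add_of_le' hs
      exact le_ciSup hbdd n
    have hP0 : 0 ≤ ⨆ n : ℕ, ((1 / 2 : ℝ) ^ (n + 1) + b * cseq β (n + 1)) :=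
      le_of_tendsto (tendsto_level hc b) ((eventually_ge_atTop 1).mono hP)
    have hupper : ∀ μ : {μ : Measure Bin // InvProb shift μ},
        kolSinai shift μ.1 + ∫ x, b * phi α (cseq β) x ∂μ.1 ≤
          ⨆ n : ℕ, ((1 / 2 : ℝ) ^ (n + 1) + b * cseq β (n + 1)) := fun μ => by
      rw [integral_const_mul]
      exact (hc.kolSinai_le hb hP0 hP μ.2).1
    have hne : Nonempty {μ : Measure Bin // InvProb shift μ} := ⟨_, (hmme 1 le_rfl).1.1⟩
    have hpressure : pressure shift (fun x => b * phi α (cseq β) x) =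
        ⨆ n : ℕ, ((1 / 2 : ℝ) ^ (n + 1) + b * cseq β (n + 1)) := by
      refine le_antisymm (ciSup_le hupper) (ciSup_le fun n => ?_)
      have := le_ciSup (f := fun μ : {μ : Measure Bin // InvProb shift μ} =>
        kolSinai shift μ.1 + ∫ x, b * phi α (cseq β) x ∂μ.1) ⟨_, Set.forall_mem_range.2 hupper⟩
        ⟨μseq (n + 1), (hmme (n + 1) (by omega)).1.1⟩
      simp only [integral_const_mul, hent (n + 1) (by omega), hint (n + 1) (by omega)] at this
      simpa only [pressure, integral_const_mul] using this
    have hpressureOn : ∀ n : ℕ, pressureOn (Xsub (n + 1)) (fun x => b * phi α (cseq β) x) =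
        (1 / 2 : ℝ) ^ (n + 1) + b * cseq β (n + 1) := fun n => by
      have hn : 1 ≤ n + 1 := by omega
      have hval : ∀ μ : {μ : Measure Bin // InvProb shift μ ∧ μ (Xsub (n + 1)) = 1},
          kolSinai shift μ.1 + ∫ x, b * phi α (cseq β) x ∂μ.1 ≤
            (1 / 2 : ℝ) ^ (n + 1) + b * cseq β (n + 1) := fun μ => by
        have := μ.2.1.1
        rw [integral_const_mul, hc.integral_phi hn μ.2.2, add_le_add_iff_right]
        exact kolSinai_le_half_pow hα hβ hmono hn μ.2.1 μ.2.2
      have hmem : InvProb shift (μseq (n + 1)) ∧ μseq (n + 1) (Xsub (n + 1)) = 1 :=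
        ⟨(hmme (n + 1) hn).1.1, (hmme (n + 1) hn).1.2.1⟩
      have hne : Nonempty {μ : Measure Bin // InvProb shift μ ∧ μ (Xsub (n + 1)) = 1} :=
        ⟨_, hmem⟩
      refine le_antisymm (ciSup_le hval) ?_
      have := le_ciSup (f := fun μ : {μ : Measure Bin // InvProb shift μ ∧ μ (Xsub (n + 1)) = 1} =>
        kolSinai shift μ.1 + ∫ x, b * phi α (cseq β) x ∂μ.1) ⟨_, Set.forall_mem_range.2 hval⟩
        ⟨μseq (n + 1), hmem⟩
      simp only [integral_const_mul, hent (n + 1) hn, hint (n + 1) hn] at this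
      simpa only [pressureOn, integral_const_mul] using this
    simp only [hpressureOn]
    exact ⟨hpressure, hpressure⟩

end PhaseTransitions
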